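/- arXiv:1610.04498 — 8 statements merged into one kernel-verified Lean document; each statement's English description precedes it below -/
import Mathlib

section
/- For every selection vector s ∈ 𝒮 and every ordering vector π ∈ Π(s), the total weight has the explicit value Σ_{i=1}^k ω_i(π) = A·β_I + (Σ_{i=1}^k (n − i) − A)·β_c, where A := k(n_I − 1) − Σ_{l=1}^L s_l (s_l − 1)/2. -/
open Finset

/-- Number of earlier occurrences of the same cluster: `#{ j < i : π j = π i }`. -/
def repCount {L k : ℕ} (π : Fin k → Fin L) (i : Fin k) : ℕ :=
  (Finset.univ.filter fun j => j < i ∧ π j = π i).card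

/-- `a_i(π) = n_I − 1 − #{ j < i : π j = π i }`. -/
def aSeq (nI : ℕ) {L k : ℕ} (π : Fin k → Fin L) (i : Fin k) : ℤ :=
  (nI : ℤ) - 1 - (repCount π i : ℤ)

/-- The `i`-th weight value `ω_i(π) = a_i(π) β_I + (n − i − a_i(π)) β_c`
(here `i : Fin k` represents the 1-indexed position `i+1`). -/
def wSeq (n nI : ℕ) (βI βc : ℝ) {L k : ℕ} (π : Fin k → Fin L) (i : Fin k) : ℝ :=
  (aSeq nI π i : ℝ) * βI + ((n : ℝ) - ((i : ℕ) + 1) - (aSeq nI π i : ℝ)) * βc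

/-- Min-cut value `c_min(s, π) = Σ_{i=1}^k min(ω_i(π), α)`. -/
def cminVal (n nI : ℕ) (βI βc α : ℝ) {L k : ℕ} (π : Fin k → Fin L) : ℝ :=
  ∑ i, min (wSeq n nI βI βc π i) α

/-- `s` is a selection vector: entries bounded by `n_I`, nonincreasing, summing to `k`. -/
def IsSelection (nI k : ℕ) {L : ℕ} (s : Fin L → ℕ) : Prop :=
  (∀ i, s i ≤ nI) ∧ (∀ i j : Fin L, i ≤ j → s j ≤ s i) ∧ ∑ i, s i = k

/-- `π` is an ordering vector for `s`: for each cluster `l`, exactly `s l` entries equal `l`. -/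
def IsOrdering {L k : ℕ} (s : Fin L → ℕ) (π : Fin k → Fin L) : Prop :=
  ∀ l, (Finset.univ.filter fun i => π i = l).card = s l

/-- The vertical ordering vector `π_v(s)`: concatenation over rounds `r = 0, 1, …` of the
clusters `l` with `s l > r`, listed in increasing order (Algorithm 1). -/
def verticalOrdering {L : ℕ} (hL : 0 < L) (k : ℕ) (s : Fin L → ℕ) : Fin k → Fin L :=
  fun i =>
    ((List.range k).flatMap fun r => (List.finRange L).filter fun l => r < s l).getD i.1 ⟨0, hL⟩

/-- The horizontal selection vector `s_h` (0-indexed clusters). -/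
def horizontalSel (L nI k : ℕ) : Fin L → ℕ :=
  fun i => if (i : ℕ) < k / nI then nI else if (i : ℕ) = k / nI then k % nI else 0

/-- In a finite subset of a linear order, the number of strictly ordered pairs is
`#S (#S - 1) / 2`. -/
theorem sum_card_filter_lt {α : Type*} [LinearOrder α] (S : Finset α) :
    ∑ i ∈ S, (((S.filter fun j => j < i).card : ℕ) : ℝ) = (S.card : ℝ) * ((S.card : ℝ) - 1) / 2 := by
  induction S using Finset.induction_on_max with
  | empty => simp
  | insert a S ha ih =>
    have hmem : a ∉ S := fun h => lt_irrefl _ (ha a h)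
    have hlast : ((insert a S).filter fun j => j < a) = S := by
      rw [Finset.filter_insert, if_neg (lt_irrefl a), Finset.filter_true_of_mem ha]
    have hrest : ∀ i ∈ S, ((insert a S).filter fun j => j < i) = S.filter fun j => j < i := by
      intro i hi
      rw [Finset.filter_insert, if_neg (ha i hi).le.not_gt]
    rw [Finset.sum_insert hmem, hlast, Finset.sum_congr rfl fun i hi => by rw [hrest i hi], ih,
      Finset.card_insert_of_notMem hmem]
    push_cast
    ring

/-- The total number of earlier repetitions depends only on the multiplicities. -/
theorem sum_repCount {L k : ℕ} {s : Fin L → ℕ} {π : Fin k → Fin L} (hπ : IsOrdering s π) :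
    ∑ i, (repCount π i : ℝ) = ∑ l, (s l : ℝ) * ((s l : ℝ) - 1) / 2 := by
  rw [← Finset.sum_fiberwise Finset.univ π]
  refine Finset.sum_congr rfl fun l _ => ?_
  rw [← hπ l, ← sum_card_filter_lt]
  refine Finset.sum_congr rfl fun i hi => ?_
  obtain rfl : π i = l := (Finset.mem_filter.mp hi).2
  simp only [repCount, Finset.filter_filter, and_comm]

/-- For every selection vector `s ∈ 𝒮` and every ordering vector `π ∈ Π(s)`, the total weight
has the explicit value `Σ_i ω_i(π) = A·β_I + (Σ_{i=1}^k (n − i) − A)·β_c` with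
`A = k(n_I − 1) − Σ_l s_l (s_l − 1)/2`. -/
theorem total_weight_explicit
    (n L k nI : ℕ) (hL : 1 ≤ L) (hn : n = L * nI) (hnI : 2 ≤ nI)
    (hk1 : 1 ≤ k) (hkn : k ≤ n)
    (βI βc : ℝ) (hβc : 0 ≤ βc) (hβIc : βc ≤ βI)
    (s : Fin L → ℕ) (hs : IsSelection nI k s)
    (π : Fin k → Fin L) (hπ : IsOrdering s π) :
    ∑ i, wSeq n nI βI βc π i =
      ((k : ℝ) * ((nI : ℝ) - 1) - ∑ l, (s l : ℝ) * ((s l : ℝ) - 1) / 2) * βI +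
        ((∑ i : Fin k, ((n : ℝ) - ((i : ℕ) + 1))) -
          ((k : ℝ) * ((nI : ℝ) - 1) - ∑ l, (s l : ℝ) * ((s l : ℝ) - 1) / 2)) * βc := by
  have hA : ∑ i, (aSeq nI π i : ℝ) =
      (k : ℝ) * ((nI : ℝ) - 1) - ∑ l, (s l : ℝ) * ((s l : ℝ) - 1) / 2 := by
    rw [← sum_repCount hπ]
    simp [aSeq, Finset.sum_sub_distrib, mul_sub]
  simp only [wSeq]
  rw [Finset.sum_add_distrib, ← Finset.sum_mul, ← Finset.sum_mul, Finset.sum_sub_distrib, hA]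
end

section
/- For every selection vector s ∈ 𝒮, the weight sequence of the vertical ordering vector is nonincreasing: ω_1(π_v(s)) ≥ ω_2(π_v(s)) ≥ … ≥ ω_k(π_v(s)). -/
open Finset

/-- In a list of length at least `m`, the number of positions below `m` holding `c` is the number
of occurrences of `c` in the prefix of length `m`. -/
theorem card_filter_getD_eq_count_take {α : Type*} [DecidableEq α] (l : List α) (d c : α) (m : ℕ)
    (hm : m ≤ l.length) :
    ((Finset.range m).filter fun j => l.getD j d = c).card = (l.take m).count c := by
  induction m with
  | zero => simp
  | succ m ih =>
    have hml : m < l.length := hm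
    rw [Finset.range_add_one, Finset.filter_insert, List.take_add_one, List.count_append,
      ← ih hml.le, List.getD_eq_getElem _ _ hml, List.getElem?_eq_getElem hml,
      Option.toList_some, List.count_singleton]
    split_ifs <;> simp_all

/-- The number of earlier repetitions, read off a list whose entries give the ordering. -/
theorem repCount_getD {L k : ℕ} (l : List (Fin L)) (d : Fin L) (hl : l.length = k) (i : Fin k) :
    repCount (fun j : Fin k => l.getD j.1 d) i = (l.take i).count (l.getD i d) := by
  rw [← card_filter_getD_eq_count_take l d _ i (by omega), repCount]
  refine Finset.card_bij (fun j _ => j.1) ?_ ?_ ?_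
  · intro j hj
    simpa only [Finset.mem_filter, Finset.mem_univ, true_and, Finset.mem_range, Fin.lt_def]
      using hj
  · intro a _ b _ h
    exact Fin.ext h
  · intro b hb
    simp only [Finset.mem_filter, Finset.mem_range] at hb
    exact ⟨⟨b, hb.1.trans i.2⟩, Finset.mem_filter.mpr ⟨Finset.mem_univ _, hb⟩, rfl⟩

/-- The clusters listed in the first `m` rounds of the vertical ordering. -/
def verticalRounds {L : ℕ} (s : Fin L → ℕ) (m : ℕ) : List (Fin L) :=
  (List.range m).flatMap fun r => (List.finRange L).filter fun l => r < s l

theorem verticalRounds_succ {L : ℕ} (s : Fin L → ℕ) (m : ℕ) :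
    verticalRounds s (m + 1) =
      verticalRounds s m ++ (List.finRange L).filter fun l => m < s l := by
  simp [verticalRounds, List.range_succ]

theorem count_verticalRounds {L : ℕ} (s : Fin L → ℕ) (m : ℕ) (c : Fin L) :
    (verticalRounds s m).count c = min m (s c) := by
  induction m with
  | zero => simp [verticalRounds]
  | succ m ih =>
    have hnd : ((List.finRange L).filter fun l => m < s l).Nodup :=
      (List.nodup_finRange L).filter _
    rw [verticalRounds_succ, List.count_append, ih, hnd.count]
    simp only [List.mem_filter, List.mem_finRange, true_and, decide_eq_true_eq]
    split_ifs <;> omega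

theorem length_verticalRounds {L : ℕ} (s : Fin L → ℕ) (m : ℕ) (hm : ∀ c, s c ≤ m) :
    (verticalRounds s m).length = ∑ c, s c := by
  rw [← Multiset.coe_card, ← Multiset.sum_count_eq_card (s := Finset.univ) (by simp)]
  exact Finset.sum_congr rfl fun c _ => by
    rw [Multiset.coe_count, count_verticalRounds, min_eq_right (hm c)]

/-- Every entry added in round `m` has exactly `m` earlier repetitions. -/
theorem count_take_verticalRounds_succ {L : ℕ} (s : Fin L → ℕ) (d : Fin L) (m i : ℕ)
    (hi : (verticalRounds s m).length ≤ i) (hi' : i < (verticalRounds s (m + 1)).length) :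
    ((verticalRounds s (m + 1)).take i).count ((verticalRounds s (m + 1)).getD i d) = m := by
  have hmem : (verticalRounds s (m + 1)).getD i d ∈
      (List.finRange L).filter fun l => m < s l := by
    rw [List.getD_eq_getElem _ _ hi']
    simp only [verticalRounds_succ]
    rw [List.getElem_append_right hi]
    exact List.getElem_mem _
  set c := (verticalRounds s (m + 1)).getD i d with hc
  have hlt : m < s c := by simpa using hmem
  have hle : m ≤ ((verticalRounds s (m + 1)).take i).count c := by
    have h : (verticalRounds s m).count c = m := by
      rw [count_verticalRounds, min_eq_left hlt.le]
    rw [verticalRounds_succ, List.take_append, List.take_of_length_le hi, List.count_append, h]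
    exact Nat.le_add_right _ _
  have htot : (verticalRounds s (m + 1)).count c = m + 1 := by
    rw [count_verticalRounds, min_eq_left hlt]
  have hge : ((verticalRounds s (m + 1)).take i).count c + 1 ≤
      (verticalRounds s (m + 1)).count c := by
    have h : ((verticalRounds s (m + 1)).take (i + 1)).count c =
        ((verticalRounds s (m + 1)).take i).count c + 1 := by
      rw [List.take_add_one, List.count_append, List.getElem?_eq_getElem hi', hc,
        List.getD_eq_getElem _ _ hi']
      simp
    rw [← h]
    exact (List.take_sublist _ _).count_le _
  omega

/-- Along the vertical rounds, the number of earlier repetitions is bounded by the number of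
rounds and nondecreasing. -/
theorem count_take_verticalRounds_mono {L : ℕ} (s : Fin L → ℕ) (d : Fin L) (m : ℕ) :
    ∀ j < (verticalRounds s m).length,
      ((verticalRounds s m).take j).count ((verticalRounds s m).getD j d) < m ∧
      ∀ i ≤ j, ((verticalRounds s m).take i).count ((verticalRounds s m).getD i d) ≤
        ((verticalRounds s m).take j).count ((verticalRounds s m).getD j d) := by
  induction m with
  | zero => simp [verticalRounds]
  | succ m ih =>
    have hold : ∀ i < (verticalRounds s m).length,
        ((verticalRounds s (m + 1)).take i).count ((verticalRounds s (m + 1)).getD i d) =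
          ((verticalRounds s m).take i).count ((verticalRounds s m).getD i d) := by
      intro i hi
      rw [verticalRounds_succ, List.take_append_of_le_length hi.le,
        List.getD_append _ _ _ _ hi]
    intro j hj
    rcases lt_or_ge j (verticalRounds s m).length with hjm | hjm
    · rw [hold j hjm]
      refine ⟨(ih j hjm).1.trans (Nat.lt_succ_self m), fun i hij => ?_⟩
      rw [hold i (hij.trans_lt hjm)]
      exact (ih j hjm).2 i hij
    · rw [count_take_verticalRounds_succ s d m j hjm hj]
      refine ⟨Nat.lt_succ_self m, fun i hij => ?_⟩
      rcases lt_or_ge i (verticalRounds s m).length with him | him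
      · rw [hold i him]
        exact (ih i him).1.le
      · rw [count_take_verticalRounds_succ s d m i him (hij.trans_lt hj)]

theorem repCount_verticalOrdering_mono {L k : ℕ} (hL : 0 < L) (s : Fin L → ℕ)
    (hs : ∑ c, s c = k) : Monotone (repCount (verticalOrdering hL k s)) := by
  have hlen : (verticalRounds s k).length = k := by
    rw [length_verticalRounds s k, hs]
    intro c
    exact hs ▸ Finset.single_le_sum (fun _ _ => Nat.zero_le _) (Finset.mem_univ c)
  have hrep := repCount_getD (verticalRounds s k) ⟨0, hL⟩ hlen
  intro i j hij
  calc repCount (verticalOrdering hL k s) i = _ := hrep i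
    _ ≤ _ := (count_take_verticalRounds_mono s ⟨0, hL⟩ k j (by omega)).2 i hij
    _ = repCount (verticalOrdering hL k s) j := (hrep j).symm

/-- For every selection vector `s ∈ 𝒮`, the weight sequence of the vertical ordering vector is
nonincreasing: `ω_1(π_v(s)) ≥ ω_2(π_v(s)) ≥ … ≥ ω_k(π_v(s))`. -/
theorem vertical_weights_antitone
    (n L k nI : ℕ) (hL : 1 ≤ L) (hn : n = L * nI) (hnI : 2 ≤ nI)
    (hk1 : 1 ≤ k) (hkn : k ≤ n)
    (βI βc : ℝ) (hβc : 0 ≤ βc) (hβIc : βc ≤ βI)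
    (s : Fin L → ℕ) (hs : IsSelection nI k s) :
    ∀ i j : Fin k, i ≤ j →
      wSeq n nI βI βc (verticalOrdering hL k s) j ≤ wSeq n nI βI βc (verticalOrdering hL k s) i := by
  intro i j hij
  have hrep : (repCount (verticalOrdering hL k s) i : ℝ) ≤ repCount (verticalOrdering hL k s) j :=
    Nat.cast_le.mpr (repCount_verticalOrdering_mono hL s hs.2.2 hij)
  have hpos : ((i : ℕ) : ℝ) ≤ ((j : ℕ) : ℝ) := Nat.cast_le.mpr hij
  simp only [wSeq, aSeq]
  push_cast
  nlinarith [mul_nonneg (sub_nonneg.mpr hrep) (sub_nonneg.mpr hβIc),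
    mul_nonneg (sub_nonneg.mpr hpos) hβc]
end

section
/- For every selection vector s ∈ 𝒮, every ordering vector π ∈ Π(s), and every prefix length 1 ≤ t ≤ k, the running weight sums satisfy S_t(π) := Σ_{i=1}^t ω_i(π) ≤ Σ_{i=1}^t ω_i(π_v(s)) =: S_t(π_v(s)); that is, the vertical ordering vector is a running sum maximizer. (Intermediate claim in the proof of Lemma 1.) -/
open Finset

/-- The strict order on (round, cluster) pairs in which the vertical ordering visits them. -/
def RoundLT {L : ℕ} (a b : ℕ × Fin L) : Prop :=
  a.1 < b.1 ∨ a.1 = b.1 ∧ a.2 < b.2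

/-- The vertical ordering with the round number of each entry recorded. -/
def verticalPairs {L : ℕ} (k : ℕ) (s : Fin L → ℕ) : List (ℕ × Fin L) :=
  (List.range k).flatMap fun r => ((List.finRange L).filter fun l => r < s l).map fun l => (r, l)

theorem map_snd_verticalPairs {L : ℕ} (k : ℕ) (s : Fin L → ℕ) :
    (verticalPairs k s).map Prod.snd =
      (List.range k).flatMap fun r => (List.finRange L).filter fun l => r < s l := by
  simp [verticalPairs, List.map_flatMap, Function.comp_def]

theorem mem_verticalPairs {L k : ℕ} {s : Fin L → ℕ} (hs : ∑ i, s i = k) (p : ℕ × Fin L) :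
    p ∈ verticalPairs k s ↔ p.1 < s p.2 := by
  have hle : s p.2 ≤ k := hs ▸ Finset.single_le_sum (fun _ _ => Nat.zero_le _) (mem_univ p.2)
  obtain ⟨r, l⟩ := p
  simp only [verticalPairs, List.mem_flatMap, List.mem_range, List.mem_map, List.mem_filter,
    List.mem_finRange, true_and, decide_eq_true_eq, Prod.mk.injEq]
  constructor
  · rintro ⟨r, -, l, h, rfl, rfl⟩
    exact h
  · exact fun h => ⟨r, h.trans_le hle, l, h, rfl, rfl⟩

theorem pairwise_verticalPairs {L : ℕ} (k : ℕ) (s : Fin L → ℕ) :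
    (verticalPairs k s).Pairwise RoundLT := by
  rw [verticalPairs, List.pairwise_flatMap]
  constructor
  · intro r _
    rw [List.pairwise_map]
    exact ((List.pairwise_lt_finRange L).filter _).imp fun h => Or.inr ⟨rfl, h⟩
  · refine List.pairwise_lt_range.imp fun {a b} hab x hx y hy => ?_
    simp only [List.mem_map] at hx hy
    obtain ⟨_, _, rfl⟩ := hx
    obtain ⟨_, _, rfl⟩ := hy
    exact Or.inl hab

theorem length_verticalPairs {L k : ℕ} {s : Fin L → ℕ} (hs : ∑ i, s i = k) :
    (verticalPairs k s).length = k := by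
  have hnd : (verticalPairs k s).Nodup :=
    (pairwise_verticalPairs k s).imp fun {a b} h hab => by
      subst hab
      simp [RoundLT] at h
  rw [← List.toFinset_card_of_nodup hnd]
  conv_rhs => rw [← hs]
  trans ((univ : Finset (Fin L)).sigma fun l => range (s l)).card
  · refine Finset.card_bij' (fun p _ => ⟨p.2, p.1⟩) (fun q _ => (q.2, q.1)) ?_ ?_ ?_ ?_ <;>
      simp [mem_verticalPairs hs]
  · simp

/-- An enumeration of the pairs `(r, l)` with `r < s l` in the order `RoundLT` has its
repetition counts given by the rounds. -/
theorem repCount_eq_fst {L k : ℕ} {s : Fin L → ℕ} {g : Fin k → ℕ × Fin L}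
    (hlt : ∀ i j, i < j → RoundLT (g i) (g j)) (hlts : ∀ i, (g i).1 < s (g i).2)
    (hsurj : ∀ p : ℕ × Fin L, p.1 < s p.2 → ∃ i, g i = p) (i : Fin k) :
    repCount (fun j => (g j).2) i = (g i).1 := by
  have himg : (univ.filter fun j => j < i ∧ (g j).2 = (g i).2).image (fun j => (g j).1) =
      range (g i).1 := by
    ext r
    simp only [mem_image, mem_filter, mem_univ, true_and, mem_range]
    constructor
    · rintro ⟨j, ⟨hj, he⟩, rfl⟩
      rcases hlt j i hj with h | h
      · exact h
      · exact absurd he h.2.ne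
    · intro hr
      obtain ⟨j, hj⟩ := hsurj (r, (g i).2) (hr.trans (hlts i))
      refine ⟨j, ⟨?_, by rw [hj]⟩, by rw [hj]⟩
      by_contra! hij
      rcases hij.eq_or_lt with rfl | hij
      · rw [hj] at hr
        exact hr.false
      · have := hlt i j hij
        rw [hj] at this
        rcases this with h | h
        · exact hr.not_gt h
        · exact h.2.false
  rw [repCount, ← card_range (g i).1, ← himg, card_image_of_injOn]
  intro a ha b hb hab
  simp only [coe_filter, mem_univ, true_and, Set.mem_ofPred_eq] at ha hb
  have hirr : ∀ x y, (g x).1 = (g y).1 → (g x).2 = (g y).2 → ¬ x < y := fun x y h1 h2 hxy => by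
    rcases hlt x y hxy with h | h
    · exact h.ne h1
    · exact h.2.ne h2
  have h2 := ha.2.trans hb.2.symm
  exact le_antisymm (not_lt.1 (hirr b a hab.symm h2.symm)) (not_lt.1 (hirr a b hab h2))

theorem repCount_lt_of_lt {L k : ℕ} (π : Fin k → Fin L) {i j : Fin k} (hij : i < j)
    (h : π i = π j) : repCount π i < repCount π j := by
  refine card_lt_card (Finset.ssubset_iff_of_subset ?_ |>.2 ⟨i, by simp [hij, h], by simp⟩)
  intro x
  simp only [mem_filter, mem_univ, true_and]
  exact fun hx => ⟨hx.1.trans hij, hx.2.trans h⟩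

theorem repCount_lt_of_isOrdering {L k : ℕ} {s : Fin L → ℕ} {π : Fin k → Fin L}
    (hπ : IsOrdering s π) (i : Fin k) : repCount π i < s (π i) := by
  rw [← hπ (π i)]
  refine card_lt_card (Finset.ssubset_iff_of_subset ?_ |>.2 ⟨i, by simp, by simp⟩)
  intro x
  simp only [mem_filter, mem_univ, true_and]
  exact fun hx => hx.2

/-- A monotone function has its smallest sums over the initial segments. -/
theorem sum_prefix_le_sum_of_card_eq {k : ℕ} {f : Fin k → ℕ} (hf : Monotone f) (t : ℕ)
    {T : Finset (Fin k)} (hT : T.card = (univ.filter fun i : Fin k => (i : ℕ) < t).card) :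
    ∑ i ∈ univ.filter (fun i : Fin k => (i : ℕ) < t), f i ≤ ∑ i ∈ T, f i := by
  set P := univ.filter fun i : Fin k => (i : ℕ) < t with hP
  rw [← sum_inter_add_sum_sdiff P T, ← sum_inter_add_sum_sdiff T P, inter_comm T P]
  refine Nat.add_le_add_left ?_ _
  have hle : ∀ i ∈ P \ T, ∀ j ∈ T \ P, f i ≤ f j := by
    intro i hi j hj
    simp only [hP, mem_sdiff, mem_filter, mem_univ, true_and] at hi hj
    exact hf (Fin.le_def.2 (by omega))
  have hcard : (P \ T).card = (T \ P).card := card_sdiff_comm hT.symm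
  obtain ⟨e⟩ : Nonempty (↥(P \ T) ≃ ↥(T \ P)) := ⟨Finset.equivOfCardEq hcard⟩
  rw [← sum_coe_sort (P \ T), ← sum_coe_sort (T \ P), ← e.sum_comp]
  exact sum_le_sum fun i _ => hle i i.2 _ (e i).2

theorem sum_repCount_verticalOrdering_le {L k : ℕ} (hL : 0 < L) {s : Fin L → ℕ}
    (hs : ∑ i, s i = k) {π : Fin k → Fin L} (hπ : IsOrdering s π) (t : ℕ) :
    ∑ i ∈ univ.filter (fun i : Fin k => (i : ℕ) < t), repCount (verticalOrdering hL k s) i ≤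
      ∑ i ∈ univ.filter (fun i : Fin k => (i : ℕ) < t), repCount π i := by
  have hlen := length_verticalPairs hs
  set g : Fin k → ℕ × Fin L := fun i => (verticalPairs k s)[(i : ℕ)]'(by omega) with hg
  have hv : verticalOrdering hL k s = fun i => (g i).2 := by
    funext i
    have hi : (i : ℕ) < (verticalPairs k s).length := by omega
    rw [verticalOrdering, ← map_snd_verticalPairs, List.getD_eq_getElem _ _ (by simpa using hi),
      List.getElem_map]
  have hlt : ∀ i j, i < j → RoundLT (g i) (g j) := fun i j hij =>
    List.pairwise_iff_getElem.1 (pairwise_verticalPairs k s) _ _ _ _ hij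
  have hlts : ∀ i, (g i).1 < s (g i).2 := fun i =>
    (mem_verticalPairs hs _).1 (List.getElem_mem _)
  have hsurj : ∀ p : ℕ × Fin L, p.1 < s p.2 → ∃ i, g i = p := fun p hp => by
    obtain ⟨j, hj, h⟩ := List.mem_iff_getElem.1 ((mem_verticalPairs hs p).2 hp)
    exact ⟨⟨j, hlen ▸ hj⟩, h⟩
  choose σ hσ using fun i => hsurj (repCount π i, π i) (repCount_lt_of_isOrdering hπ i)
  have hinj : Function.Injective σ := by
    intro a b hab
    have h := (hσ a).symm.trans ((congrArg g hab).trans (hσ b))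
    rw [Prod.mk.injEq] at h
    rcases lt_trichotomy a b with hlt | rfl | hlt
    · exact absurd h.1 (repCount_lt_of_lt π hlt h.2).ne
    · rfl
    · exact absurd h.1 (repCount_lt_of_lt π hlt h.2.symm).ne'
  have hmono : Monotone fun i => (g i).1 := by
    intro i j hij
    rcases hij.eq_or_lt with rfl | hij
    · exact le_rfl
    · rcases hlt i j hij with h | h
      · exact h.le
      · exact h.1.le
  simp only [hv, repCount_eq_fst hlt hlts hsurj]
  refine (sum_prefix_le_sum_of_card_eq hmono t (card_image_of_injective _ hinj)).trans_eq ?_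
  rw [sum_image hinj.injOn]
  exact sum_congr rfl fun i _ => by rw [hσ]

theorem wSeq_eq (n nI : ℕ) (βI βc : ℝ) {L k : ℕ} (π : Fin k → Fin L) (i : Fin k) :
    wSeq n nI βI βc π i =
      ((nI - 1) * (βI - βc) + (n - ((i : ℕ) + 1)) * βc) - (βI - βc) * (repCount π i : ℝ) := by
  simp only [wSeq, aSeq]
  push_cast
  ring

/-- For every selection vector `s ∈ 𝒮`, every ordering vector `π ∈ Π(s)` and every
`1 ≤ t ≤ k`, the running weight sums satisfy `S_t(π) ≤ S_t(π_v(s))`: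
the vertical ordering vector is a running sum maximizer. -/
theorem vertical_maximizes_running_sums
    (n L k nI : ℕ) (hL : 1 ≤ L) (hn : n = L * nI) (hnI : 2 ≤ nI)
    (hk1 : 1 ≤ k) (hkn : k ≤ n)
    (βI βc : ℝ) (hβc : 0 ≤ βc) (hβIc : βc ≤ βI)
    (s : Fin L → ℕ) (hs : IsSelection nI k s)
    (π : Fin k → Fin L) (hπ : IsOrdering s π) :
    ∀ t : ℕ, 1 ≤ t → t ≤ k →
      ∑ i ∈ Finset.univ.filter (fun i : Fin k => (i : ℕ) < t), wSeq n nI βI βc π i ≤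
        ∑ i ∈ Finset.univ.filter (fun i : Fin k => (i : ℕ) < t),
          wSeq n nI βI βc (verticalOrdering hL k s) i := by
  intro t _ _
  simp only [wSeq_eq, sum_sub_distrib, ← mul_sum]
  have h : (∑ i ∈ univ.filter (fun i : Fin k => (i : ℕ) < t),
      (repCount (verticalOrdering hL k s) i : ℝ)) ≤
      ∑ i ∈ univ.filter (fun i : Fin k => (i : ℕ) < t), (repCount π i : ℝ) := by
    exact_mod_cast sum_repCount_verticalOrdering_le hL hs.2.2 hπ t
  exact sub_le_sub_left (mul_le_mul_of_nonneg_left h (sub_nonneg.2 hβIc)) _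
end

section
/- For every selection vector s ∈ 𝒮 and every ordering vector π ∈ Π(s), c_min(s_h, π_v(s_h)) ≤ c_min(s, π); that is, the pair consisting of the horizontal selection vector and its vertical ordering vector minimizes the min-cut value over all selection and ordering vectors. (Combined inequality (inequality (9)) in the proof of Theorem 1.) -/
open Finset

theorem sum_eq_sum_range_card_filter_lt {ι : Type*} (S : Finset ι) (f : ι → ℕ) (M : ℕ)
    (hM : ∀ i ∈ S, f i ≤ M) :
    ∑ i ∈ S, f i = ∑ t ∈ range M, (S.filter fun i => t < f i).card := by
  simp only [card_filter]
  rw [sum_comm]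
  refine sum_congr rfl fun i hi => ?_
  rw [← card_filter]
  have : (range M).filter (fun t => t < f i) = range (f i) := by
    ext t
    have := hM i hi
    simp only [mem_filter, mem_range]
    omega
  rw [this, card_range]

theorem card_filter_ge_sub {k m : ℕ} (hm : m ≤ k) :
    (univ.filter fun i : Fin k => k - m ≤ i.1).card = m := by
  have h : (univ.filter fun i : Fin k => k - m ≤ i.1).card = (Ico (k - m) k).card := by
    refine card_bij (fun j _ => j.1) ?_ (fun a _ b _ h => Fin.ext h) ?_
    · intro j hj
      simpa using hj
    · intro j hj
      rw [mem_Ico] at hj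
      exact ⟨⟨j, hj.2⟩, by simpa using hj.1, rfl⟩
  rw [h, Nat.card_Ico]
  omega

/-- If every strict superlevel set of `f` is at most as large as that of the monotone function `g`,
then any sum of `m` values of `f` is bounded by the sum of the last `m` values of `g`. -/
theorem sum_le_sum_top {k : ℕ} (f g : Fin k → ℕ) (hg : Monotone g)
    (h : ∀ t, (univ.filter fun i => t < f i).card ≤ (univ.filter fun i => t < g i).card)
    (S : Finset (Fin k)) :
    ∑ i ∈ S, f i ≤ ∑ i ∈ univ.filter (fun i : Fin k => k - S.card ≤ i.1), g i := by
  have hS : S.card ≤ k := by simpa using S.card_le_univ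
  have hT := card_filter_ge_sub hS
  set T := univ.filter (fun i : Fin k => k - S.card ≤ i.1) with hTdef
  rw [sum_eq_sum_range_card_filter_lt S f (univ.sup f + univ.sup g)
      fun i _ => (le_sup (f := f) (mem_univ i)).trans (Nat.le_add_right _ _),
    sum_eq_sum_range_card_filter_lt T g (univ.sup f + univ.sup g)
      fun i _ => (le_sup (f := g) (mem_univ i)).trans (Nat.le_add_left _ _)]
  refine sum_le_sum fun t _ => ?_
  by_cases hsub : ∀ i ∈ T, t < g i
  · rw [filter_true_of_mem hsub, hT]
    exact card_filter_le _ _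
  · push Not at hsub
    obtain ⟨i, hi, hit⟩ := hsub
    have hG : (univ.filter fun j => t < g j) ⊆ T.filter fun j => t < g j := by
      intro j hj
      simp only [mem_filter, mem_univ, true_and, hTdef] at hj hi ⊢
      refine ⟨?_, hj⟩
      have : i ≤ j := by
        by_contra hlt
        have := hg (le_of_not_ge hlt)
        omega
      exact hi.trans this
    calc (S.filter fun i => t < f i).card
        ≤ (univ.filter fun i => t < f i).card := card_le_card (filter_subset_filter _ (subset_univ _))
      _ ≤ _ := h t
      _ ≤ _ := card_le_card hG

theorem sum_comp_repCount {L k : ℕ} (s : Fin L → ℕ) (π : Fin k → Fin L) (hπ : IsOrdering s π)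
    (F : ℕ → ℕ) : ∑ i, F (repCount π i) = ∑ l, ∑ j ∈ range (s l), F j := by
  rw [← sum_fiberwise univ π]
  refine sum_congr rfl fun l _ => ?_
  have hinj : Set.InjOn (repCount π) (univ.filter fun i => π i = l) := by
    have key : ∀ i j, π i = l → π j = l → i < j → repCount π i < repCount π j := by
      intro i j hi hj hij
      refine card_lt_card (ssubset_iff_of_subset ?_ |>.2 ⟨i, ?_, ?_⟩)
      · intro x hx
        simp only [mem_filter, mem_univ, true_and] at hx ⊢
        exact ⟨hx.1.trans hij, by rw [hx.2, hi, hj]⟩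
      · simp [hij, hi, hj]
      · simp
    intro i hi j hj hij
    simp only [coe_filter, mem_univ, true_and, Set.mem_ofPred_eq] at hi hj
    rcases lt_trichotomy i j with hlt | heq | hgt
    · exact absurd hij (key i j hi hj hlt).ne
    · exact heq
    · exact absurd hij (key j i hj hi hgt).ne'
  have himg : (univ.filter fun i => π i = l).image (repCount π) = range (s l) := by
    refine eq_of_subset_of_card_le ?_ ?_
    · intro r hr
      obtain ⟨i, hi, rfl⟩ := mem_image.1 hr
      simp only [mem_filter, mem_univ, true_and] at hi
      rw [mem_range, ← hπ l]
      refine card_lt_card (ssubset_iff_of_subset ?_ |>.2 ⟨i, ?_, ?_⟩)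
      · intro x hx
        simp only [mem_filter, mem_univ, true_and] at hx ⊢
        rw [hx.2, hi]
      · simp [hi]
      · simp
    · rw [card_image_of_injOn hinj, hπ l, card_range]
  rw [← himg, sum_image hinj]

theorem card_repCount_gt {L k : ℕ} (s : Fin L → ℕ) (π : Fin k → Fin L) (hπ : IsOrdering s π)
    (t : ℕ) : (univ.filter fun i => t < repCount π i).card = ∑ l, (s l - (t + 1)) := by
  rw [card_filter, sum_comp_repCount s π hπ fun r => if t < r then 1 else 0]
  refine sum_congr rfl fun l _ => ?_
  rw [← card_filter]
  have : (range (s l)).filter (fun r => t < r) = Ico (t + 1) (s l) := by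
    ext r
    simp only [mem_filter, mem_range, mem_Ico]
    omega
  rw [this, Nat.card_Ico]

theorem sum_ite_lt_eq {L q : ℕ} (A B : ℕ) (hq : q ≤ L) (hB : q = L → B = 0) :
    ∑ i : Fin L, (if (i : ℕ) < q then A else if (i : ℕ) = q then B else 0) = q * A + B := by
  rw [Fin.sum_univ_eq_sum_range fun i => if i < q then A else if i = q then B else 0]
  rw [← sum_range_add_sum_Ico _ hq, sum_congr rfl (g := fun _ => A) (by simp +contextual)]
  rw [sum_congr (s₁ := Ico q L) rfl (g := fun i => if q = i then B else 0)]
  · rw [sum_ite_eq]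
    simp only [sum_const, card_range, smul_eq_mul, mem_Ico, le_refl, true_and]
    split_ifs with h
    · rfl
    · rw [hB (by omega)]
  · intro i hi
    simp only [mem_Ico] at hi
    simp [hi.1.not_gt, eq_comm]

theorem div_le_and_mod_eq_zero (L nI k : ℕ) (hk : k ≤ L * nI) :
    k / nI ≤ L ∧ (k / nI = L → k % nI = 0) := by
  have h := Nat.div_add_mod k nI
  constructor
  · exact Nat.div_le_of_le_mul (by rwa [mul_comm])
  · intro he
    rw [he, mul_comm] at h
    omega

theorem sum_horizontalSel (L nI k : ℕ) (hk : k ≤ L * nI) :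
    ∑ l, horizontalSel L nI k l = k := by
  obtain ⟨h1, h2⟩ := div_le_and_mod_eq_zero L nI k hk
  unfold horizontalSel
  rw [sum_ite_lt_eq _ _ h1 h2, mul_comm, Nat.div_add_mod]

/-- Truncated sums over selections are maximized by the horizontal one. -/
theorem sum_sub_le_horizontalSel {L nI k : ℕ} (hk : k ≤ L * nI) (s : Fin L → ℕ)
    (hs : ∀ l, s l ≤ nI) (hsum : ∑ l, s l = k) (t : ℕ) :
    ∑ l, (s l - t) ≤ ∑ l, (horizontalSel L nI k l - t) := by
  obtain ⟨h1, h2⟩ := div_le_and_mod_eq_zero L nI k hk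
  have hR : ∑ l, (horizontalSel L nI k l - t) = k / nI * (nI - t) + (k % nI - t) := by
    rw [← sum_ite_lt_eq _ _ h1 fun h => by rw [h2 h, Nat.zero_sub]]
    refine sum_congr rfl fun l _ => ?_
    unfold horizontalSel
    split_ifs <;> simp
  rw [hR]
  have hdm := Nat.div_add_mod k nI
  set q := k / nI
  set m := k % nI
  set P := univ.filter fun l => t < s l
  have hsplit : ∑ l, (s l - t) = ∑ l ∈ P, (s l - t) := by
    symm
    refine sum_subset (subset_univ _) fun l _ hl => ?_
    simp only [P, mem_filter, mem_univ, true_and] at hl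
    omega
  have hb1 : ∑ l ∈ P, (s l - t) ≤ P.card * (nI - t) := by
    rw [← smul_eq_mul]
    exact sum_le_card_nsmul _ _ _ fun l _ => Nat.sub_le_sub_right (hs l) t
  have hb2 : ∑ l ∈ P, (s l - t) + P.card * t ≤ k := by
    rw [← smul_eq_mul, ← sum_const, ← sum_add_distrib, ← hsum]
    calc ∑ l ∈ P, (s l - t + t) = ∑ l ∈ P, s l := sum_congr rfl fun l hl => by
          simp only [P, mem_filter, mem_univ, true_and] at hl
          omega
      _ ≤ _ := sum_le_sum_of_subset (subset_univ _)
  rw [hsplit]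
  rcases Nat.lt_or_ge q P.card with hp | hp
  · have h3 : (q + 1) * t ≤ P.card * t := Nat.mul_le_mul_right _ hp
    have h4 : q * nI ≤ q * (nI - t) + q * t := by
      rw [← mul_add]
      exact Nat.mul_le_mul_left _ (by omega)
    rw [add_mul] at h3
    rw [mul_comm] at hdm
    omega
  · exact hb1.trans ((Nat.mul_le_mul_right _ hp).trans (Nat.le_add_right _ _))

/-- The clusters listed in the first `T` rounds of the vertical ordering of `s`. -/
def rounds {L : ℕ} (s : Fin L → ℕ) (T : ℕ) : List (Fin L) :=
  (List.range T).flatMap fun r => (List.finRange L).filter fun l => r < s l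

theorem rounds_succ {L : ℕ} (s : Fin L → ℕ) (T : ℕ) :
    rounds s (T + 1) = rounds s T ++ (List.finRange L).filter fun l => T < s l := by
  simp [rounds, List.range_succ]

theorem count_rounds {L : ℕ} (s : Fin L → ℕ) (T : ℕ) (l : Fin L) :
    (rounds s T).count l = min T (s l) := by
  induction T with
  | zero => simp [rounds]
  | succ T ih =>
    rw [rounds_succ, List.count_append, ih]
    by_cases h : T < s l
    · rw [List.count_filter (by simpa using h),
        List.count_eq_one_of_mem (List.nodup_finRange L) (List.mem_finRange l)]
      omega
    · rw [List.count_eq_zero_of_not_mem (by simpa using h)]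
      omega

theorem length_rounds {L : ℕ} (s : Fin L → ℕ) (T : ℕ) :
    (rounds s T).length = ∑ l, min T (s l) := by
  rw [← sum_congr rfl fun l _ => count_rounds s T l]
  have := Multiset.sum_count_eq_card (s := univ) (m := (rounds s T : Multiset (Fin L))) (by simp)
  simpa using this.symm

/-- The number of occurrences of `V[i]` before position `i`. -/
def listRank {α : Type*} [DecidableEq α] (V : List α) (d : α) (i : ℕ) : ℕ :=
  (V.take i).count (V.getD i d)

theorem listRank_rounds {L : ℕ} (s : Fin L → ℕ) (d : Fin L) (T : ℕ) :
    (∀ i < (rounds s T).length, listRank (rounds s T) d i < T) ∧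
    ∀ i j, i ≤ j → j < (rounds s T).length →
      listRank (rounds s T) d i ≤ listRank (rounds s T) d j := by
  induction T with
  | zero => simp [rounds]
  | succ T ih =>
    obtain ⟨ih1, ih2⟩ := ih
    set B := (List.finRange L).filter (fun l => T < s l) with hB
    have hold : ∀ i < (rounds s T).length,
        listRank (rounds s (T + 1)) d i = listRank (rounds s T) d i := by
      intro i hi
      rw [listRank, listRank, rounds_succ, List.take_append_of_le_length hi.le,
        List.getD_append _ _ _ _ hi]
    have hnew : ∀ i, (rounds s T).length ≤ i → i < (rounds s (T + 1)).length →
        listRank (rounds s (T + 1)) d i = T := by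
      intro i hi hlt
      rw [rounds_succ, ← hB, List.length_append] at hlt
      have hlt' : i - (rounds s T).length < B.length := by omega
      rw [listRank, rounds_succ, ← hB, List.take_append, List.take_of_length_le hi,
        List.getD_append_right _ _ _ _ hi, List.getD_eq_getElem _ _ hlt', List.count_append,
        count_rounds]
      have hmem : B[i - (rounds s T).length] ∈ B := List.getElem_mem _
      have hs : T < s B[i - (rounds s T).length] := by
        have := (List.mem_filter.1 hmem).2
        simpa using this
      have hnd : B.Nodup := (List.nodup_finRange L).filter _
      rw [List.count_eq_zero_of_not_mem]
      · omega
      · intro hm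
        obtain ⟨a, ha, hae⟩ := List.mem_iff_getElem.1 hm
        rw [List.getElem_take, hnd.getElem_inj_iff] at hae
        rw [List.length_take] at ha
        omega
    constructor
    · intro i hi
      rcases Nat.lt_or_ge i (rounds s T).length with h | h
      · rw [hold i h]
        exact (ih1 i h).trans (Nat.lt_succ_self T)
      · rw [hnew i h hi]
        exact Nat.lt_succ_self T
    · intro i j hij hj
      rcases Nat.lt_or_ge j (rounds s T).length with h | h
      · rw [hold i (hij.trans_lt h), hold j h]
        exact ih2 i j hij h
      · rw [hnew j h hj]
        rcases Nat.lt_or_ge i (rounds s T).length with h' | h'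
        · rw [hold i h']
          exact (ih1 i h').le
        · rw [hnew i h' (hij.trans_lt hj)]

theorem count_take_eq_card {α : Type*} [DecidableEq α] (V : List α) (d a : α) (m : ℕ)
    (hm : m ≤ V.length) :
    (V.take m).count a = ((range m).filter fun j => V.getD j d = a).card := by
  induction m with
  | zero => simp
  | succ m ih =>
    rw [range_add_one, filter_insert, List.take_add_one, List.count_append, ih (by omega),
      List.getD_eq_getElem _ _ (by omega), List.getElem?_eq_getElem (by omega)]
    split_ifs with h
    · simp [h]
    · simp [h]

theorem repCount_getD_s10 {L k : ℕ} (V : List (Fin L)) (d : Fin L) (hV : V.length = k) (i : Fin k) :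
    repCount (fun i : Fin k => V.getD i.1 d) i = listRank V d i.1 := by
  rw [listRank, count_take_eq_card V d _ _ (by omega), repCount]
  refine card_bij (fun j _ => j.1) ?_ ?_ ?_
  · intro j hj
    simpa using hj
  · intro a _ b _ h
    exact Fin.ext h
  · intro j hj
    simp only [mem_filter, mem_range] at hj
    exact ⟨⟨j, hj.1.trans i.2⟩, mem_filter.2 ⟨mem_univ _, hj⟩, rfl⟩

theorem isOrdering_getD {L k : ℕ} (V : List (Fin L)) (d : Fin L) (hV : V.length = k) :
    IsOrdering (fun l => V.count l) (fun i : Fin k => V.getD i.1 d) := by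
  intro l
  have h := count_take_eq_card V d l k hV.ge
  rw [List.take_of_length_le hV.le] at h
  refine Eq.trans ?_ h.symm
  refine card_bij (fun j _ => j.1) ?_ (fun a _ b _ h => Fin.ext h) ?_
  · intro j hj
    simpa using hj
  · intro j hj
    simp only [mem_filter, mem_range] at hj
    exact ⟨⟨j, hj.1⟩, by simpa using hj.2, rfl⟩

theorem isOrdering_verticalOrdering {L k : ℕ} (hL : 0 < L) (s : Fin L → ℕ) (hs : ∑ l, s l = k) :
    IsOrdering s (verticalOrdering hL k s) ∧ Monotone (repCount (verticalOrdering hL k s)) := by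
  have hmin : ∀ l, min k (s l) = s l := fun l =>
    min_eq_right (hs ▸ single_le_sum (fun _ _ => Nat.zero_le _) (mem_univ l))
  have hlen : (rounds s k).length = k := by
    rw [length_rounds, sum_congr rfl fun l _ => hmin l, hs]
  have hv : verticalOrdering hL k s = fun i : Fin k => (rounds s k).getD i.1 ⟨0, hL⟩ := rfl
  rw [hv]
  constructor
  · have h := isOrdering_getD (rounds s k) ⟨0, hL⟩ hlen
    simpa only [count_rounds, hmin] using h
  · intro i j hij
    rw [repCount_getD_s10 _ _ hlen, repCount_getD_s10 _ _ hlen]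
    exact (listRank_rounds s ⟨0, hL⟩ k).2 i j hij (hlen.symm ▸ j.2)

theorem sum_wSeq (n nI : ℕ) (βI βc : ℝ) {L k : ℕ} (π : Fin k → Fin L) (S : Finset (Fin k)) :
    ∑ i ∈ S, wSeq n nI βI βc π i =
      S.card * ((nI - 1) * βI + (n - nI) * βc) -
        (βI - βc) * ((∑ i ∈ S, repCount π i : ℕ) : ℝ) - βc * ((∑ i ∈ S, i.1 : ℕ) : ℝ) := by
  push_cast
  rw [mul_sum, mul_sum, ← nsmul_eq_mul, ← sum_const, ← sum_sub_distrib, ← sum_sub_distrib]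
  refine sum_congr rfl fun i _ => ?_
  simp only [wSeq, aSeq]
  push_cast
  ring

theorem sum_min_eq {ι : Type*} [Fintype ι] (w : ι → ℝ) (α : ℝ) :
    ∑ i, min (w i) α = ∑ i ∈ univ.filter (fun i => w i ≤ α), w i +
      ((Fintype.card ι : ℝ) - (univ.filter fun i => w i ≤ α).card) * α := by
  classical
  set T := univ.filter fun i => w i ≤ α with hT
  have hc : ((Tᶜ.card : ℕ) : ℝ) = (Fintype.card ι : ℝ) - T.card := by
    rw [card_compl, Nat.cast_sub (card_le_univ T)]
  rw [← sum_add_sum_compl T, ← hc, ← nsmul_eq_mul, ← sum_const]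
  congr 1
  · refine sum_congr rfl fun i hi => min_eq_left ?_
    simpa [hT] using hi
  · refine sum_congr rfl fun i hi => min_eq_right ?_
    exact (by simpa [hT] using hi : α < w i).le

theorem sum_min_le {ι : Type*} [Fintype ι] [DecidableEq ι] (w : ι → ℝ) (α : ℝ) (T : Finset ι) :
    ∑ i, min (w i) α ≤ ∑ i ∈ T, w i + ((Fintype.card ι : ℝ) - T.card) * α := by
  have hc : ((Tᶜ.card : ℕ) : ℝ) = (Fintype.card ι : ℝ) - T.card := by
    rw [card_compl, Nat.cast_sub (card_le_univ T)]
  rw [← sum_add_sum_compl T, ← hc, ← nsmul_eq_mul, ← sum_const]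
  exact add_le_add (sum_le_sum fun i _ => min_le_left _ _) (sum_le_sum fun i _ => min_le_right _ _)

/-- For every selection vector `s ∈ 𝒮` and every ordering vector `π ∈ Π(s)`,
`c_min(s_h, π_v(s_h)) ≤ c_min(s, π)`: the pair consisting of the horizontal selection vector and
its vertical ordering vector minimizes the min-cut value over all selection and ordering vectors. -/
theorem horizontal_vertical_minimizes_mincut
    (n L k nI : ℕ) (hL : 1 ≤ L) (hn : n = L * nI) (hnI : 2 ≤ nI)
    (hk1 : 1 ≤ k) (hkn : k ≤ n)
    (βI βc : ℝ) (hβc : 0 ≤ βc) (hβIc : βc ≤ βI) (α : ℝ) (hα : 0 ≤ α)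
    (s : Fin L → ℕ) (hs : IsSelection nI k s)
    (π : Fin k → Fin L) (hπ : IsOrdering s π) :
    cminVal n nI βI βc α (verticalOrdering hL k (horizontalSel L nI k)) ≤
      cminVal n nI βI βc α π := by
  subst hn
  obtain ⟨hv, hmono⟩ := isOrdering_verticalOrdering hL _ (sum_horizontalSel L nI k hkn)
  set v := verticalOrdering hL k (horizontalSel L nI k)
  set S := univ.filter fun i => wSeq (L * nI) nI βI βc π i ≤ α with hS
  set T := univ.filter fun i : Fin k => k - S.card ≤ i.1
  have hT : T.card = S.card := card_filter_ge_sub (by simpa using S.card_le_univ)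
  have hrep : ∑ i ∈ S, repCount π i ≤ ∑ i ∈ T, repCount v i := by
    refine sum_le_sum_top _ _ hmono (fun t => ?_) S
    rw [card_repCount_gt s π hπ, card_repCount_gt _ v hv]
    exact sum_sub_le_horizontalSel hkn s hs.1 hs.2.2 (t + 1)
  have hpos : ∑ i ∈ S, i.1 ≤ ∑ i ∈ T, i.1 :=
    sum_le_sum_top (fun i => i.1) (fun i => i.1) (fun _ _ h => h) (fun _ => le_rfl) S
  have hsum : ∑ i ∈ T, wSeq (L * nI) nI βI βc v i ≤ ∑ i ∈ S, wSeq (L * nI) nI βI βc π i := by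
    rw [sum_wSeq, sum_wSeq, hT]
    have h1 := mul_le_mul_of_nonneg_left (Nat.cast_le (α := ℝ).2 hrep) (sub_nonneg.2 hβIc)
    have h2 := mul_le_mul_of_nonneg_left (Nat.cast_le (α := ℝ).2 hpos) hβc
    linarith
  unfold cminVal
  rw [sum_min_eq (wSeq (L * nI) nI βI βc π) α, ← hS]
  refine (sum_min_le _ α T).trans ?_
  rw [hT]
  exact add_le_add_left hsum _
end

section
/- (Closed-form identity of Theorem 1) Assume L ≥ 2. The min-cut value of the horizontal selection vector with its vertical ordering equals the capacity formula: c_min(s_h, π_v(s_h)) = Σ_{i=1}^{n_I} Σ_{j=1}^{g(i)} min(α, x(i) γ_I + y(i, j) γ_c), where γ_I = (n_I − 1) β_I, γ_c = (n − n_I) β_c, x(i) = (n_I − i)/(n_I − 1), y(i, j) = (n − (n_I − i) − Σ_{m=1}^{i−1} g(m) − j)/(n − n_I), and g(i) = ⌊k/n_I⌋ + 1 if 1 ≤ i ≤ (k mod n_I) and g(i) = ⌊k/n_I⌋ otherwise. -/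
open Finset

/-- `g(i) = ⌊k/n_I⌋ + 1` if `1 ≤ i ≤ (k mod n_I)`, else `⌊k/n_I⌋`. -/
def gFun (nI k : ℕ) (i : ℕ) : ℕ :=
  if 1 ≤ i ∧ i ≤ k % nI then k / nI + 1 else k / nI

/-- The capacity formula of Theorem 1, with `γ_I = (n_I − 1) β_I`, `γ_c = (n − n_I) β_c`,
`x(i) = (n_I − i)/(n_I − 1)` and `y(i,j) = (n − (n_I − i) − Σ_{m=1}^{i−1} g(m) − j)/(n − n_I)`. -/
noncomputable def capacityFormula (n nI k : ℕ) (α βI βc : ℝ) : ℝ :=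
  ∑ i ∈ Finset.Icc 1 nI, ∑ j ∈ Finset.Icc 1 (gFun nI k i),
    min α (((nI : ℝ) - (i : ℝ)) / ((nI : ℝ) - 1) * (((nI : ℝ) - 1) * βI) +
      ((n : ℝ) - ((nI : ℝ) - (i : ℝ)) - (∑ m ∈ Finset.Icc 1 (i - 1), (gFun nI k m : ℝ)) - (j : ℝ)) /
        ((n : ℝ) - (nI : ℝ)) * (((n : ℝ) - (nI : ℝ)) * βc))

theorem sum_Icc_one_eq_sum_range {M : Type*} [AddCommMonoid M] (f : ℕ → M) (N : ℕ) :
    ∑ i ∈ Finset.Icc 1 N, f i = ∑ i ∈ Finset.range N, f (i + 1) := by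
  induction N with
  | zero => simp
  | succ N ih => rw [Finset.sum_Icc_succ_top (by omega), ih, Finset.sum_range_succ]

/-- Summing over consecutive blocks of lengths `G 0, G 1, …`. -/
theorem sum_range_sum_eq_sum_blocks {M : Type*} [AddCommMonoid M] (G : ℕ → ℕ) (f : ℕ → M)
    (N : ℕ) :
    ∑ i ∈ Finset.range (∑ r ∈ Finset.range N, G r), f i =
      ∑ r ∈ Finset.range N, ∑ j ∈ Finset.range (G r),
        f (∑ m ∈ Finset.range r, G m + j) := by
  induction N with
  | zero => simp
  | succ N ih =>
    rw [Finset.sum_range_succ (fun r => G r), Finset.sum_range_add, ih,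
      Finset.sum_range_succ _ N]

theorem length_flatMap_range {β : Type*} (F : ℕ → List β) (K : ℕ) :
    ((List.range K).flatMap F).length = ∑ m ∈ Finset.range K, (F m).length := by
  induction K with
  | zero => simp
  | succ K ih => rw [List.range_succ, List.flatMap_append, List.length_append, ih,
      Finset.sum_range_succ]; simp

theorem getD_flatMap_range {β : Type*} (F : ℕ → List β) (d : β) {K r j : ℕ} (hr : r < K)
    (hj : j < (F r).length) :
    ((List.range K).flatMap F).getD (∑ m ∈ Finset.range r, (F m).length + j) d =
      (F r).getD j d := by
  induction K with
  | zero => omega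
  | succ K ih =>
    rw [List.range_succ, List.flatMap_append]
    rcases Nat.lt_succ_iff_lt_or_eq.mp hr with h | rfl
    · rw [List.getD_append, ih h]
      rw [length_flatMap_range]
      have h1 := Finset.sum_le_sum_of_subset (f := fun m => (F m).length)
        (Finset.range_subset_range.mpr (Nat.succ_le_of_lt h))
      rw [Finset.sum_range_succ] at h1
      omega
    · rw [List.getD_append_right _ _ _ _ (by rw [length_flatMap_range]; omega),
        length_flatMap_range, Nat.add_sub_cancel_left]
      simp

theorem filter_lt_range (c N : ℕ) :
    (List.range N).filter (fun l => decide (l < c)) = List.range (min c N) := by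
  induction N with
  | zero => simp
  | succ N ih =>
    rw [List.range_succ, List.filter_append, ih]
    by_cases h : N < c
    · rw [show min c (N + 1) = N + 1 by omega, show min c N = N by omega, List.range_succ]
      simp [h]
    · rw [show min c (N + 1) = c by omega, show min c N = c by omega]
      simp [h]

theorem map_val_filter_finRange (L c : ℕ) :
    ((List.finRange L).filter (fun l : Fin L => decide ((l : ℕ) < c))).map Fin.val =
      List.range (min c L) := by
  rw [← filter_lt_range, ← List.map_coe_finRange_eq_range, List.filter_map]
  rfl

theorem length_filter_finRange (L c : ℕ) :
    ((List.finRange L).filter (fun l : Fin L => decide ((l : ℕ) < c))).length = min c L := by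
  simpa using congrArg List.length (map_val_filter_finRange L c)

theorem val_getD_filter_finRange {L c j : ℕ} (d : Fin L) (hj : j < min c L) :
    (((List.finRange L).filter (fun l : Fin L => decide ((l : ℕ) < c))).getD j d : ℕ) = j := by
  have h : ((List.finRange L).filter (fun l : Fin L => decide ((l : ℕ) < c))).length = min c L :=
    length_filter_finRange L c
  rw [List.getD_eq_getElem _ _ (by omega)]
  have h2 := map_val_filter_finRange L c
  have h3 : (((List.finRange L).filter (fun l : Fin L => decide ((l : ℕ) < c))).map Fin.val)[j]'(by
      rw [List.length_map]; omega) = j := by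
    simp only [h2, List.getElem_range]
  simpa only [List.getElem_map] using h3

/-- The number of clusters taking part in round `r` of the vertical ordering of the horizontal
selection vector. -/
def roundSize (nI k r : ℕ) : ℕ :=
  if r < nI then gFun nI k (r + 1) else 0

theorem lt_horizontalSel_iff {L nI k : ℕ} (r : ℕ) (l : Fin L) (hnI : 0 < nI) :
    r < horizontalSel L nI k l ↔ (l : ℕ) < roundSize nI k r := by
  have := Nat.mod_lt k hnI
  unfold horizontalSel roundSize gFun
  split_ifs <;> omega

theorem roundSize_le {L nI k : ℕ} (hk : k ≤ L * nI) (r : ℕ) :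
    roundSize nI k r ≤ L := by
  have h1 : k / nI ≤ L := Nat.div_le_of_le_mul (by rwa [mul_comm] at hk)
  have h2 := Nat.div_add_mod k nI
  have h3 : k / nI = L → k % nI = 0 := by
    intro h
    rw [h, mul_comm] at h2
    omega
  unfold roundSize gFun
  split_ifs <;> omega

theorem roundSize_antitone (nI k : ℕ) : Antitone (roundSize nI k) := by
  intro a b h
  unfold roundSize gFun
  generalize k / nI = q, k % nI = t
  split_ifs <;> omega

theorem lt_of_lt_roundSize {nI k r j : ℕ} (h : j < roundSize nI k r) : r < k := by
  unfold roundSize gFun at h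
  have h1 := Nat.mod_le k nI
  by_cases hq : k / nI = 0
  · split_ifs at h <;> omega
  · have := (Nat.div_ne_zero_iff.mp hq).2
    split_ifs at h <;> omega

theorem sum_roundSize {nI k : ℕ} (hnI : 0 < nI) :
    ∑ r ∈ Finset.range nI, roundSize nI k r = k := by
  have key : ∀ N ≤ nI, ∑ r ∈ Finset.range N, roundSize nI k r =
      N * (k / nI) + min N (k % nI) := by
    intro N hN
    induction N with
    | zero => simp
    | succ N ih =>
      rw [Finset.sum_range_succ, ih (by omega), add_mul]
      unfold roundSize gFun
      split_ifs <;> omega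
  rw [key nI le_rfl, min_eq_right (Nat.mod_lt k hnI).le]
  exact Nat.div_add_mod k nI

theorem verticalOrdering_horizontalSel {L nI k : ℕ} (hL : 0 < L) (hnI : 0 < nI)
    (hk : k ≤ L * nI) {r j : ℕ} (hj : j < roundSize nI k r) (i : Fin k)
    (hi : (i : ℕ) = ∑ m ∈ Finset.range r, roundSize nI k m + j) :
    (verticalOrdering hL k (horizontalSel L nI k) i : ℕ) = j := by
  have hlen : ∀ m, ((List.finRange L).filter
      (fun l : Fin L => decide ((l : ℕ) < roundSize nI k m))).length = roundSize nI k m := fun m => by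
    rw [length_filter_finRange, min_eq_left (roundSize_le hk m)]
  have h := getD_flatMap_range
    (fun m => (List.finRange L).filter (fun l : Fin L => decide ((l : ℕ) < roundSize nI k m)))
    (⟨0, hL⟩ : Fin L) (lt_of_lt_roundSize hj) (by rw [hlen]; exact hj)
  simp only [hlen] at h
  unfold verticalOrdering
  simp only [lt_horizontalSel_iff _ _ hnI, hi, h]
  exact val_getD_filter_finRange _ (by have := roundSize_le hk r; omega)

theorem repCount_verticalOrdering_horizontalSel {L nI k : ℕ} (hL : 0 < L) (hnI : 0 < nI)
    (hk : k ≤ L * nI) {r j : ℕ} (hj : j < roundSize nI k r) (i : Fin k)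
    (hi : (i : ℕ) = ∑ m ∈ Finset.range r, roundSize nI k m + j) :
    repCount (verticalOrdering hL k (horizontalSel L nI k)) i = r := by
  set π := verticalOrdering hL k (horizontalSel L nI k) with hπ
  let f : ℕ → ℕ := fun a => if h : a < k then (if (π ⟨a, h⟩ : ℕ) = j then 1 else 0) else 0
  have hf : ∀ r' j', j' < roundSize nI k r' →
      ∑ m ∈ Finset.range r', roundSize nI k m + j' < i →
      f (∑ m ∈ Finset.range r', roundSize nI k m + j') = if j' = j then 1 else 0 := by
    intro r' j' hj' hlt
    have hlt' := hlt.trans i.2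
    have := verticalOrdering_horizontalSel hL hnI hk hj' ⟨_, hlt'⟩ rfl
    simp only [f, dif_pos hlt', hπ, this]
  have hcard : repCount π i = ∑ a ∈ Finset.range i, f a := by
    have hπi : (π i : ℕ) = j := verticalOrdering_horizontalSel hL hnI hk hj i hi
    have h1 : ∑ a ∈ Finset.range i, f a =
        ∑ a ∈ Finset.range k, if a < i then f a else 0 := by
      rw [← Finset.sum_filter]
      congr 1
      ext a
      have := i.2
      simp only [Finset.mem_range, Finset.mem_filter]
      omega
    rw [h1, ← Fin.sum_univ_eq_sum_range (fun a => if a < (i : ℕ) then f a else 0), repCount,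
      Finset.card_filter]
    refine Finset.sum_congr rfl fun a _ => ?_
    simp only [f, a.2, dif_pos, Fin.lt_def, Fin.ext_iff, hπi, ite_and]
  rw [hcard, hi, Finset.sum_range_add, sum_range_sum_eq_sum_blocks]
  have hA : ∀ r' ∈ Finset.range r, ∑ j' ∈ Finset.range (roundSize nI k r'),
      f (∑ m ∈ Finset.range r', roundSize nI k m + j') = 1 := by
    intro r' hr'
    rw [Finset.mem_range] at hr'
    have hb := Finset.sum_le_sum_of_subset (f := roundSize nI k)
      (Finset.range_subset_range.mpr (Nat.succ_le_of_lt hr'))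
    rw [Finset.sum_range_succ] at hb
    have hjr : j < roundSize nI k r' := hj.trans_le (roundSize_antitone nI k hr'.le)
    rw [Finset.sum_congr rfl (g := fun j' => if j' = j then 1 else 0)]
    · simp [hjr]
    · intro j' hj'
      rw [Finset.mem_range] at hj'
      exact hf r' j' hj' (by omega)
  have hB : ∀ j' ∈ Finset.range j, f (∑ m ∈ Finset.range r, roundSize nI k m + j') = 0 := by
    intro j' hj'
    rw [Finset.mem_range] at hj'
    rw [hf r j' (hj'.trans hj) (by omega), if_neg hj'.ne]
  rw [Finset.sum_congr rfl hA, Finset.sum_eq_zero hB]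
  simp

/-- **Closed-form identity of Theorem 1.** For `L ≥ 2`, the min-cut value of the horizontal
selection vector with its vertical ordering equals the capacity formula
`Σ_{i=1}^{n_I} Σ_{j=1}^{g(i)} min(α, x(i) γ_I + y(i,j) γ_c)`. -/
theorem capacity_closed_form
    (n L k nI : ℕ) (hL : 2 ≤ L) (hn : n = L * nI) (hnI : 2 ≤ nI)
    (hk1 : 1 ≤ k) (hkn : k ≤ n)
    (βI βc : ℝ) (hβc : 0 ≤ βc) (hβIc : βc ≤ βI) (α : ℝ) (hα : 0 ≤ α) :
    cminVal n nI βI βc α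
        (verticalOrdering (show 0 < L by omega) k (horizontalSel L nI k)) =
      capacityFormula n nI k α βI βc := by
  have hnI0 : 0 < nI := by omega
  subst hn
  have hL0 : 0 < L := by omega
  set π := verticalOrdering hL0 k (horizontalSel L nI k) with hπ
  let f : ℕ → ℝ := fun a =>
    if h : a < k then min (wSeq (L * nI) nI βI βc π ⟨a, h⟩) α else 0
  have hsum : cminVal (L * nI) nI βI βc α π = ∑ a ∈ Finset.range k, f a := by
    rw [← Fin.sum_univ_eq_sum_range, cminVal]
    exact Finset.sum_congr rfl fun a _ => by simp [f]
  have hg : ∀ r < nI, gFun nI k (r + 1) = roundSize nI k r := fun r hr => by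
    rw [roundSize, if_pos hr]
  rw [hsum, capacityFormula, sum_Icc_one_eq_sum_range]
  conv_lhs => rw [← sum_roundSize (k := k) hnI0]
  rw [sum_range_sum_eq_sum_blocks]
  refine Finset.sum_congr rfl fun r hr => ?_
  rw [Finset.mem_range] at hr
  rw [sum_Icc_one_eq_sum_range, hg r hr]
  refine Finset.sum_congr rfl fun j hj => ?_
  rw [Finset.mem_range] at hj
  have hlt : ∑ m ∈ Finset.range r, roundSize nI k m + j < k := by
    have hb := Finset.sum_le_sum_of_subset (f := roundSize nI k)
      (Finset.range_subset_range.mpr (Nat.succ_le_of_lt hr))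
    rw [Finset.sum_range_succ, sum_roundSize hnI0] at hb
    omega
  have hstart : ∑ m ∈ Finset.Icc 1 (r + 1 - 1), (gFun nI k m : ℝ) =
      ((∑ m ∈ Finset.range r, roundSize nI k m : ℕ) : ℝ) := by
    rw [Nat.add_sub_cancel, sum_Icc_one_eq_sum_range, Nat.cast_sum]
    refine Finset.sum_congr rfl fun m hm => ?_
    rw [hg m ((Finset.mem_range.mp hm).trans hr)]
  have hrep : repCount π ⟨_, hlt⟩ = r :=
    repCount_verticalOrdering_horizontalSel hL0 hnI0 hkn hj ⟨_, hlt⟩ rfl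
  have hnI' : (2 : ℝ) ≤ nI := by exact_mod_cast hnI
  have hL' : (2 : ℝ) ≤ L := by exact_mod_cast hL
  have hne1 : (nI : ℝ) - 1 ≠ 0 := by linarith
  have hne2 : ((L * nI : ℕ) : ℝ) - nI ≠ 0 := by
    push_cast
    nlinarith
  simp only [f, dif_pos hlt]
  rw [min_comm, hstart, ← mul_assoc, ← mul_assoc, div_mul_cancel₀ _ hne1,
    div_mul_cancel₀ _ hne2, wSeq, aSeq, hrep]
  congr 1
  push_cast
  ring
end

section
/- If β_I = β_c = β ≥ 0, the capacity formula of Theorem 1 reduces to the capacity of the non-clustered distributed storage system of Dimakis et al.: C(α, β, β) = Σ_{i=1}^{k} min(α, (n − i) β). -/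
open Finset

theorem sum_Icc_add (f : ℕ → ℝ) (a b : ℕ) :
    ∑ i ∈ Icc 1 (a + b), f i = ∑ i ∈ Icc 1 a, f i + ∑ j ∈ Icc 1 b, f (a + j) := by
  induction b with
  | zero => simp
  | succ b ih =>
    rw [← add_assoc, sum_Icc_succ_top (by omega), sum_Icc_succ_top (by omega), ih, ← add_assoc,
      ← add_assoc]

/-- Summing over consecutive blocks of lengths `g 1, …, g N` is summing over their union. -/
theorem sum_Icc_blocks (f : ℕ → ℝ) (g : ℕ → ℕ) (N : ℕ) :
    ∑ i ∈ Icc 1 N, ∑ j ∈ Icc 1 (g i), f (∑ m ∈ Icc 1 (i - 1), g m + j) =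
      ∑ i ∈ Icc 1 (∑ m ∈ Icc 1 N, g m), f i := by
  induction N with
  | zero => simp
  | succ N ih =>
    rw [sum_Icc_succ_top (by omega), sum_Icc_succ_top (by omega), ih, sum_Icc_add,
      Nat.add_sub_cancel]

theorem sum_gFun_Icc (nI k N : ℕ) :
    ∑ m ∈ Icc 1 N, gFun nI k m = N * (k / nI) + min N (k % nI) := by
  induction N with
  | zero => simp
  | succ N ih =>
    rw [sum_Icc_succ_top (by omega), ih, gFun, Nat.succ_mul]
    split_ifs <;> omega

theorem sum_gFun {nI : ℕ} (k : ℕ) (h : 0 < nI) : ∑ m ∈ Icc 1 nI, gFun nI k m = k := by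
  rw [sum_gFun_Icc, min_eq_right (Nat.mod_lt k h).le, Nat.div_add_mod]

/-- If `β_I = β_c = β ≥ 0`, the capacity formula of Theorem 1 reduces to the capacity of the
non-clustered distributed storage system of Dimakis et al.:
`C(α, β, β) = Σ_{i=1}^k min(α, (n − i) β)`. -/
theorem capacity_reduces_to_nonclustered
    (n L k nI : ℕ) (hL : 2 ≤ L) (hn : n = L * nI) (hnI : 2 ≤ nI)
    (hk1 : 1 ≤ k) (hkn : k ≤ n)
    (α β : ℝ) (hβ : 0 ≤ β) (hα : 0 ≤ α) :
    capacityFormula n nI k α β β = ∑ i ∈ Finset.Icc 1 k, min α (((n : ℝ) - (i : ℝ)) * β) := by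
  have hI : (nI : ℝ) - 1 ≠ 0 := by
    have : (2 : ℝ) ≤ nI := by exact_mod_cast hnI
    linarith
  have hc : (n : ℝ) - nI ≠ 0 := by
    have : nI < n := by rw [hn]; nlinarith
    exact sub_ne_zero.mpr (by exact_mod_cast this.ne')
  have key := sum_Icc_blocks (fun i => min α (((n : ℝ) - (i : ℝ)) * β)) (gFun nI k) nI
  rw [sum_gFun k (by omega)] at key
  rw [← key, capacityFormula]
  refine sum_congr rfl fun i _ => sum_congr rfl fun j _ => ?_
  congr 1
  rw [← mul_assoc, ← mul_assoc, div_mul_cancel₀ _ hI, div_mul_cancel₀ _ hc]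
  push_cast
  ring
end

section
/- (Optimality of symmetric repair) Let β_I ≥ β_c ≥ 0 and let β := ((n_I − 1) β_I + (n − n_I) β_c)/(n − 1), so that the total repair bandwidth γ = (n_I − 1)β_I + (n − n_I)β_c = (n − 1)β is preserved. Then the capacity satisfies C(α, β_I, β_c) ≤ C(α, β, β) = Σ_{i=1}^{k} min(α, (n − i) β); that is, for fixed node storage size α and total repair bandwidth γ, symmetric repair (β_I = β_c) maximizes the capacity. -/
open Finset

/-- Length of the `p`-th row counted from the last one: the last `c` rows have `A - 1` entries,
all the others `A`. -/
def rowLen (A c p : ℕ) : ℕ := if p < c then A - 1 else A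

/-- Total length of the last `p` rows. -/
def tailLen (A c p : ℕ) : ℕ := ∑ q ∈ range p, rowLen A c q

lemma tailLen_succ (A c p : ℕ) : tailLen A c (p + 1) = tailLen A c p + rowLen A c p :=
  sum_range_succ _ _

lemma tailLen_add_min {A : ℕ} (hA : 1 ≤ A) (c p : ℕ) : tailLen A c p + min p c = A * p := by
  induction p with
  | zero => simp [tailLen]
  | succ p ih =>
    rw [tailLen_succ, rowLen, mul_add]
    split_ifs <;> omega

lemma gFun_eq_rowLen {nI k A c i : ℕ} (hA : 1 ≤ A) (hc : c < nI) (hk : k + c = A * nI)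
    (hi : 1 ≤ i) (hi' : i ≤ nI) : gFun nI k i = rowLen A c (nI - i) := by
  obtain ⟨A, rfl⟩ : ∃ a, A = a + 1 := ⟨A - 1, by omega⟩
  rcases Nat.eq_zero_or_pos c with rfl | hc0
  · have hk' : k = nI * (A + 1) := by linarith
    have h1 : k / nI = A + 1 := by rw [hk']; exact Nat.mul_div_cancel_left _ hc
    have h2 : k % nI = 0 := by rw [hk']; exact Nat.mul_mod_right _ _
    simp [gFun, rowLen, h1, h2]
    omega
  · have hk' : k = (nI - c) + nI * A := by
      have : (A + 1) * nI = nI * A + nI := by ring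
      omega
    have hlt : nI - c < nI := by omega
    have h1 : k / nI = A := by
      rw [hk', Nat.add_mul_div_left _ _ (by omega), Nat.div_eq_of_lt hlt, zero_add]
    have h2 : k % nI = nI - c := by rw [hk', Nat.add_mul_mod_self_left, Nat.mod_eq_of_lt hlt]
    simp only [gFun, rowLen, h1, h2]
    split_ifs <;> omega

lemma sum_gFun_add_tailLen {nI k A c : ℕ} (hA : 1 ≤ A) (hc : c < nI) (hk : k + c = A * nI)
    {p : ℕ} (hp : p ≤ nI) : ∑ m ∈ Icc 1 (nI - p), gFun nI k m + tailLen A c p = k := by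
  induction hp using Nat.decreasingInduction with
  | self =>
    have := tailLen_add_min hA c nI
    simp
    omega
  | of_succ p hp ih =>
    have h : nI - p = nI - (p + 1) + 1 := by omega
    rw [h, sum_Icc_succ_top (by omega), ← h, gFun_eq_rowLen hA hc hk (by omega) (by omega),
      Nat.sub_sub_self hp.le]
    rw [tailLen_succ] at ih
    omega

/-- The capacity as a sum over the rows in reverse order, each read backwards. -/
lemma capacityFormula_eq_sum_rows {n nI k A c : ℕ} (hA : 1 ≤ A) (hc : c < nI)
    (hk : k + c = A * nI) (hnI : 2 ≤ nI) (hn : nI < n) (α βI βc : ℝ) :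
    capacityFormula n nI k α βI βc = ∑ p ∈ range nI, ∑ v ∈ range (rowLen A c p),
      min α (p * βI + (n - k + (tailLen A c p + v : ℕ) - p) * βc) := by
  have hnI' : (2 : ℝ) ≤ nI := by exact_mod_cast hnI
  have hn' : (nI : ℝ) < n := by exact_mod_cast hn
  have h1 : (nI : ℝ) - 1 ≠ 0 := by linarith
  have h2 : (n : ℝ) - nI ≠ 0 := by linarith
  unfold capacityFormula
  refine sum_nbij' (fun i => nI - i) (fun p => nI - p) ?_ ?_ ?_ ?_ ?_
  · intro i hi; simp at hi ⊢; omega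
  · intro i hi; simp at hi ⊢; omega
  · intro i hi; simp at hi ⊢; omega
  · intro i hi; simp at hi ⊢; omega
  intro i hi
  rw [mem_Icc] at hi
  have hg := gFun_eq_rowLen hA hc hk hi.1 hi.2
  rw [hg]
  refine sum_nbij' (fun j => rowLen A c (nI - i) - j) (fun v => rowLen A c (nI - i) - v)
    ?_ ?_ ?_ ?_ ?_
  · intro j hj; simp at hj ⊢; omega
  · intro j hj; simp at hj ⊢; omega
  · intro j hj; simp at hj ⊢; omega
  · intro j hj; simp at hj ⊢; omega
  intro j hj
  rw [mem_Icc] at hj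
  have hs := sum_gFun_add_tailLen hA hc hk (p := nI - i + 1) (by omega)
  rw [show nI - (nI - i + 1) = i - 1 by omega, tailLen_succ] at hs
  have hs' : (∑ m ∈ Icc 1 (i - 1), (gFun nI k m : ℝ)) +
      (tailLen A c (nI - i) + rowLen A c (nI - i)) = k := by exact_mod_cast hs
  congr 1
  push_cast [Nat.cast_sub hi.2, Nat.cast_sub hj.2]
  rw [← hs']
  field_simp
  ring

lemma sum_rows_eq_sum_range {M : Type*} [AddCommMonoid M] (A c P : ℕ) (f : ℕ → M) :
    ∑ p ∈ range P, ∑ v ∈ range (rowLen A c p), f (tailLen A c p + v) =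
      ∑ w ∈ range (tailLen A c P), f w := by
  induction P with
  | zero => simp [tailLen]
  | succ P ih => rw [sum_range_succ, ih, tailLen_succ, sum_range_add]

lemma two_mul_sum_rowLen_mul {A : ℕ} (hA : 1 ≤ A) (c P : ℕ) :
    2 * ∑ p ∈ range P, (rowLen A c p : ℤ) * p =
      A * P * (P - 1) - (min P c : ℕ) * ((min P c : ℕ) - 1) := by
  induction P with
  | zero => simp
  | succ P ih =>
    rw [sum_range_succ, mul_add, ih, rowLen]
    split_ifs with h
    · rw [min_eq_left h.le, min_eq_left (by omega : P + 1 ≤ c)]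
      push_cast [hA]; ring
    · rw [min_eq_right (by omega), min_eq_right (by omega)]
      push_cast; ring

/-- The sum of the row indices of the first `σ` entries, counted from the last one. -/
lemma exists_row_decomposition {A : ℕ} (hA : 1 ≤ A) (c : ℕ) {P : ℕ} (hP : 1 ≤ P) {σ : ℕ}
    (hσ : σ ≤ tailLen A c P) :
    ∃ p u : ℕ, p < P ∧ u ≤ A ∧ σ = tailLen A c p + u ∧
      2 * ∑ q ∈ range P, ∑ v ∈ range (rowLen A c q), (if tailLen A c q + v < σ then (q : ℤ) else 0)
        = A * p * (p - 1) - (min p c : ℕ) * ((min p c : ℕ) - 1) + 2 * p * u := by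
  have key : ∀ P, tailLen A c P ≤ σ → σ ≤ tailLen A c (P + 1) →
      ∃ p u : ℕ, p < P + 1 ∧ u ≤ A ∧ σ = tailLen A c p + u ∧
      2 * ∑ q ∈ range (P + 1), ∑ v ∈ range (rowLen A c q),
        (if tailLen A c q + v < σ then (q : ℤ) else 0)
        = A * p * (p - 1) - (min p c : ℕ) * ((min p c : ℕ) - 1) + 2 * p * u := by
    intro P h1 h2
    obtain ⟨u, rfl⟩ := Nat.exists_eq_add_of_le h1
    rw [tailLen_succ] at h2
    have hu : u ≤ rowLen A c P := by omega
    have hr : rowLen A c P ≤ A := by unfold rowLen; split_ifs <;> omega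
    refine ⟨P, u, by omega, by omega, rfl, ?_⟩
    rw [sum_range_succ, mul_add, ← two_mul_sum_rowLen_mul hA]
    congr 1
    · congr 1
      refine sum_congr rfl fun q hq => ?_
      rw [mem_range] at hq
      have hm : tailLen A c (q + 1) ≤ tailLen A c P :=
        sum_le_sum_of_subset (range_subset_range.2 hq)
      rw [tailLen_succ] at hm
      rw [sum_congr rfl (g := fun _ => (q : ℤ)) fun v hv => if_pos (by
        rw [mem_range] at hv; omega)]
      simp
    · have : (range (rowLen A c P)).filter (fun v => v < u) = range u := by
        ext v; simp; omega
      simp only [add_lt_add_iff_left]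
      rw [← sum_filter, this]
      simp; ring
  induction P, hP using Nat.le_induction with
  | base => exact key 0 (by simp [tailLen]) hσ
  | succ P hP ih =>
    rcases le_total σ (tailLen A c P) with h | h
    · obtain ⟨p, u, hp, hu, hs, he⟩ := ih h
      refine ⟨p, u, by omega, hu, hs, ?_⟩
      rw [sum_range_succ, sum_eq_zero (s := range (rowLen A c P)), add_zero, he]
      intro v _
      rw [if_neg (by omega)]
    · exact key P h hσ

lemma Int.mul_sub_one_nonneg (z : ℤ) : 0 ≤ z * (z - 1) := by
  rcases le_or_gt z 0 with h | h
  · exact mul_nonneg_of_nonpos_of_nonpos h (by omega)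
  · exact mul_nonneg h.le (by omega)

/-- Polynomial inequality comparing the partial sums of row indices with an arithmetic series. -/
lemma row_index_polynomial_le {n k nI A c p u e N : ℤ} (hA : 1 ≤ A) (hk : k + c = A * nI)
    (hn : A * nI ≤ n) (hp0 : 0 ≤ p) (hp : p + 1 ≤ nI) (hu0 : 0 ≤ u)
    (hep : e ≤ p) (hec : e ≤ c) (hN : N + e = A * p + u) (hN0 : 0 ≤ N) :
    (n - 1) * (A * p * (p - 1) - e * (e - 1) + 2 * p * u) ≤
      (nI - 1) * (N * (2 * (n - k) + N - 1)) := by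
  obtain ⟨x, hx⟩ : ∃ x, n = A * nI + x := ⟨n - A * nI, by ring⟩
  have hx0 : 0 ≤ x := by omega
  obtain ⟨y, hy⟩ : ∃ y, c = e + y := ⟨c - e, by ring⟩
  have hy0 : 0 ≤ y := by omega
  obtain ⟨z, hz⟩ : ∃ z, nI = p + 1 + z := ⟨nI - (p + 1), by ring⟩
  have hz0 : 0 ≤ z := by omega
  obtain ⟨B, hB⟩ : ∃ B, A = B + 1 := ⟨A - 1, by ring⟩
  have hB0 : 0 ≤ B := by omega
  obtain ⟨d, hd⟩ : ∃ d, p = e + d := ⟨p - e, by ring⟩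
  have hd0 : 0 ≤ d := by omega
  have hNI : 0 ≤ nI - 1 := by omega
  have hslope : 0 ≤ 2 * (nI - 1) * N - (A * p * (p - 1) - e * (e - 1) + 2 * p * u) := by
    have : 2 * (nI - 1) * N - (A * p * (p - 1) - e * (e - 1) + 2 * p * u) =
        2 * u * z + B * p * (p + 1 + 2 * z) + d * (d + 1 + 2 * z) := by
      rw [show N = A * p + u - e by omega, hB, hz, hd]; ring
    rw [this]; positivity
  have h1 := Int.mul_sub_one_nonneg (A - u)
  have h2 := Int.mul_sub_one_nonneg u
  have h3 := Int.mul_sub_one_nonneg e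
  have hid : (nI - 1) * (N * (2 * (n - k) + N - 1)) -
      (n - 1) * (A * p * (p - 1) - e * (e - 1) + 2 * p * u) =
      x * (2 * (nI - 1) * N - (A * p * (p - 1) - e * (e - 1) + 2 * p * u)) +
      2 * ((nI - 1) * (N * y)) + B * nI * (e * (e - 1)) +
      (A * B * p * z + p * ((A - u) * (A - u - 1)) + z * (u * (u - 1))) := by
    rw [show k = A * nI - c by omega, show N = A * p + u - e by omega, hx, hy, hz, hB]; ring
  have hnI0 : 0 ≤ nI := by omega
  have : 0 ≤ (nI - 1) * (N * (2 * (n - k) + N - 1)) -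
      (n - 1) * (A * p * (p - 1) - e * (e - 1) + 2 * p * u) := by
    rw [hid]; positivity
  linarith

lemma exists_row_parameters {k nI : ℕ} (hnI : 0 < nI) (hk : 1 ≤ k) :
    ∃ A c : ℕ, 1 ≤ A ∧ c < nI ∧ k + c = A * nI := by
  have h := Nat.div_add_mod (k - 1) nI
  have h' := Nat.mod_lt (k - 1) hnI
  refine ⟨(k - 1) / nI + 1, nI - 1 - (k - 1) % nI, Nat.le_add_left 1 _, by omega, ?_⟩
  have : ((k - 1) / nI + 1) * nI = nI * ((k - 1) / nI) + nI := by ring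
  omega

/-- Partial sums of the row indices, weighted, are bounded by those of the symmetric sequence. -/
lemma sum_row_index_le {n k nI A c σ : ℕ} (hA : 1 ≤ A) (hc : c < nI) (hk : k + c = A * nI)
    (hn : A * nI ≤ n) (hσ : σ ≤ k) :
    ((n : ℝ) - 1) * ∑ p ∈ range nI, ∑ v ∈ range (rowLen A c p),
        (if tailLen A c p + v < σ then (p : ℝ) else 0) ≤
      ((nI : ℝ) - 1) * ∑ w ∈ range σ, ((n : ℝ) - k + w) := by
  have hR : tailLen A c nI = k := by
    have := tailLen_add_min hA c nI
    omega
  obtain ⟨p, u, hp, hu, hs, he⟩ := exists_row_decomposition hA c (by omega : 1 ≤ nI) (hR ▸ hσ)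
  have hm := tailLen_add_min hA c p
  have hpoly := row_index_polynomial_le (n := n) (k := k) (nI := nI) (A := A) (c := c) (p := p)
    (u := u) (e := (min p c : ℕ)) (N := σ) (by exact_mod_cast hA) (by exact_mod_cast hk)
    (by exact_mod_cast hn) (by positivity) (by exact_mod_cast hp) (by positivity)
    (by exact_mod_cast min_le_left p c) (by exact_mod_cast min_le_right p c)
    (by zify at hm hs; push_cast; linarith) (by positivity)
  rw [← he] at hpoly
  have hpoly' : ((n : ℝ) - 1) * (2 * ∑ p ∈ range nI, ∑ v ∈ range (rowLen A c p),
        (if tailLen A c p + v < σ then (p : ℝ) else 0)) ≤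
      ((nI : ℝ) - 1) * (σ * (2 * (n - k) + σ - 1)) := by exact_mod_cast hpoly
  have hsum : ∀ σ : ℕ, 2 * ∑ w ∈ range σ, ((n : ℝ) - k + w) = σ * (2 * (n - k) + σ - 1) := by
    intro σ
    induction σ with
    | zero => simp
    | succ σ ih => rw [sum_range_succ, mul_add, ih]; push_cast; ring
  rw [← hsum] at hpoly'
  linarith

/-- **Optimality of symmetric repair.** Let `β_I ≥ β_c ≥ 0` and
`β = ((n_I − 1) β_I + (n − n_I) β_c)/(n − 1)`, so that the total repair bandwidth
`γ = (n_I − 1)β_I + (n − n_I)β_c = (n − 1)β` is preserved. Then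
`C(α, β_I, β_c) ≤ C(α, β, β) = Σ_{i=1}^k min(α, (n − i) β)`. -/
theorem symmetric_repair_optimal
    (n L k nI : ℕ) (hL : 2 ≤ L) (hn : n = L * nI) (hnI : 2 ≤ nI)
    (hk1 : 1 ≤ k) (hkn : k ≤ n)
    (βI βc : ℝ) (hβc : 0 ≤ βc) (hβIc : βc ≤ βI) (α : ℝ) (hα : 0 ≤ α)
    (β : ℝ) (hβ : β = (((nI : ℝ) - 1) * βI + ((n : ℝ) - (nI : ℝ)) * βc) / ((n : ℝ) - 1)) :
    capacityFormula n nI k α βI βc ≤ capacityFormula n nI k α β β ∧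
      capacityFormula n nI k α β β =
        ∑ i ∈ Finset.Icc 1 k, min α (((n : ℝ) - (i : ℝ)) * β) := by
  obtain ⟨A, c, hA, hc, hk⟩ := exists_row_parameters (by omega : 0 < nI) hk1
  have hnInn : nI < n := by rw [hn]; nlinarith
  have hAL : A ≤ L := by
    by_contra! h
    have := Nat.mul_le_mul_right nI (show L + 1 ≤ A from h)
    rw [add_mul] at this
    omega
  have hAn : A * nI ≤ n := hn ▸ Nat.mul_le_mul_right nI hAL
  have hR : tailLen A c nI = k := by
    have := tailLen_add_min hA c nI
    omega
  have hnI' : (2 : ℝ) ≤ nI := by exact_mod_cast hnI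
  have hn' : (nI : ℝ) < n := by exact_mod_cast hnInn
  have hkn' : (k : ℝ) ≤ n := by exact_mod_cast hkn
  have hn1 : 0 < (n : ℝ) - 1 := by linarith
  have hβ0 : 0 ≤ β := by
    rw [hβ]
    have : 0 ≤ βI := hβc.trans hβIc
    exact div_nonneg (add_nonneg (mul_nonneg (by linarith) this)
      (mul_nonneg (by linarith) hβc)) hn1.le
  have hsym : ∀ p w : ℕ, (p : ℝ) * β + (n - k + (w : ℕ) - p) * β = (n - k + w) * β := by
    intros; ring
  rw [capacityFormula_eq_sum_rows hA hc hk hnI hnInn,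
    capacityFormula_eq_sum_rows hA hc hk hnI hnInn]
  simp only [hsym]
  refine ⟨?_, ?_⟩
  · -- the entries of the symmetric sequence below `α` form an initial segment of length `σ`
    obtain ⟨σ, hσk, hσ⟩ : ∃ σ ≤ k, ∀ w < k, w < σ ↔ ((n : ℝ) - k + w) * β ≤ α := by
      by_cases h : ∃ w : ℕ, α < ((n : ℝ) - k + w) * β
      · classical
        refine ⟨min k (Nat.find h), min_le_left _ _, fun w hw => ?_⟩
        rw [lt_min_iff]
        refine ⟨fun hw' => not_lt.1 (Nat.find_min h hw'.2), fun hw' => ⟨hw, ?_⟩⟩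
        by_contra! hle
        have hle' : (Nat.find h : ℝ) ≤ w := by exact_mod_cast hle
        have := Nat.find_spec h
        nlinarith
      · push Not at h
        exact ⟨k, le_rfl, fun w hw => ⟨fun _ => h w, fun _ => hw⟩⟩
    have hmain := sum_row_index_le hA hc hk hAn hσk
    have hflat : ∑ w ∈ range σ, ((n : ℝ) - k + w) =
        ∑ p ∈ range nI, ∑ v ∈ range (rowLen A c p),
          if tailLen A c p + v < σ then (n : ℝ) - k + (tailLen A c p + v : ℕ) else 0 := by
      rw [sum_rows_eq_sum_range A c nI (fun w => if w < σ then (n : ℝ) - k + (w : ℕ) else 0), hR,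
        ← sum_filter]
      congr 1
      ext w; simp; omega
    rw [hflat] at hmain
    have hδ : 0 ≤ (βI - βc) / ((n : ℝ) - 1) := div_nonneg (by linarith) hn1.le
    have hterm : ∀ p ∈ range nI, ∀ v ∈ range (rowLen A c p),
        min α (p * βI + (n - k + (tailLen A c p + v : ℕ) - p) * βc) ≤
        min α ((n - k + (tailLen A c p + v : ℕ)) * β) + (βI - βc) / ((n : ℝ) - 1) *
          (((n : ℝ) - 1) * (if tailLen A c p + v < σ then (p : ℝ) else 0) - ((nI : ℝ) - 1) *
          (if tailLen A c p + v < σ then (n : ℝ) - k + (tailLen A c p + v : ℕ) else 0)) := by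
      intro p hp v hv
      rw [mem_range] at hp hv
      have hlt : tailLen A c p + v < k := by
        have : tailLen A c (p + 1) ≤ tailLen A c nI :=
          sum_le_sum_of_subset (range_subset_range.2 hp)
        rw [tailLen_succ] at this
        omega
      have hw := hσ _ hlt
      generalize tailLen A c p + v = w at *
      split_ifs with h
      · rw [min_eq_right (hw.1 h)]
        refine (min_le_right _ _).trans (le_of_eq ?_)
        rw [hβ]
        field_simp
        ring
      · rw [min_eq_left (not_le.1 (mt hw.2 h)).le]
        simp
    refine (sum_le_sum fun p hp => sum_le_sum (hterm p hp)).trans ?_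
    simp only [sum_add_distrib, ← mul_sum, sum_sub_distrib]
    have := mul_nonpos_of_nonneg_of_nonpos hδ (sub_nonpos.2 hmain)
    linarith
  · rw [sum_rows_eq_sum_range A c nI (fun w => min α (((n : ℝ) - k + (w : ℕ)) * β)), hR]
    refine sum_nbij' (fun w => k - w) (fun i => k - i) ?_ ?_ ?_ ?_ ?_
    · intro i hi; simp at hi ⊢; omega
    · intro i hi; simp at hi ⊢; omega
    · intro i hi; simp at hi ⊢; omega
    · intro i hi; simp at hi ⊢; omega
    · intro w hw
      rw [mem_range] at hw
      rw [Nat.cast_sub hw.le]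
      congr 2
      ring
end

section
/- (Corollary 1: intra-cluster repairable condition) Define the threshold function γ_I^*(α) by: γ_I^*(α) := (M − δ_t α)/ε_t whenever α ∈ [ M/(ε_t/b_t + δ_t), M/(ε_{t−1}/b_{t−1} + δ_{t−1}) ) for some integer 1 ≤ t ≤ n_I − 2, and γ_I^*(α) := M/ε_0 whenever α ≥ M/ε_0. Then for every α in the above range and every γ_I ≥ 0: C_0(α, γ_I) ≥ M if and only if γ_I ≥ γ_I^*(α). In particular, with zero cross-cluster repair bandwidth (γ_c = 0), a file of size M can be reliably stored exactly when γ_I ≥ γ_I^*(α), and it is impossible when γ_I < γ_I^*(α). -/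
open Finset

/-- The capacity with zero cross-cluster repair bandwidth:
`C_0(α, γ_I) = Σ_{i=1}^{n_I} g(i) · min(α, ((n_I − i)/(n_I − 1)) γ_I)`. -/
noncomputable def C0 (nI k : ℕ) (α γI : ℝ) : ℝ :=
  ∑ i ∈ Finset.Icc 1 nI, (gFun nI k i : ℝ) * min α (((nI : ℝ) - (i : ℝ)) / ((nI : ℝ) - 1) * γI)

/-- `b_t = 1 − t/(n_I − 1)`. -/
noncomputable def bFun (nI t : ℕ) : ℝ := 1 - (t : ℝ) / ((nI : ℝ) - 1)

/-- `ε_t = ⌊k/n_I⌋ · Σ_{i=t}^{n_I−1} b_i + Σ_{i=t}^{k − ⌊k/n_I⌋·n_I − 1} b_i`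
(note `k − ⌊k/n_I⌋·n_I = k mod n_I`; the second sum is empty when `t ≥ k mod n_I`). -/
noncomputable def epsFun (nI k t : ℕ) : ℝ :=
  ((k / nI : ℕ) : ℝ) * (∑ i ∈ Finset.Ico t nI, bFun nI i) + ∑ i ∈ Finset.Ico t (k % nI), bFun nI i

/-- `δ_t = (⌊k/n_I⌋ + 1)·t` for `0 ≤ t ≤ k mod n_I`, and
`δ_t = k − ⌊k/n_I⌋·(n_I − t)` for `k mod n_I < t ≤ n_I − 1`. -/
noncomputable def deltaFun (nI k t : ℕ) : ℝ :=
  if t ≤ k % nI then (((k / nI : ℕ) : ℝ) + 1) * (t : ℝ)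
  else (k : ℝ) - ((k / nI : ℕ) : ℝ) * ((nI : ℝ) - (t : ℝ))

/-- The threshold of the piecewise linear function `γ ↦ ∑ w j * min α (b j * γ)`, at a
level `M` attained at a point `x` where the first `t` terms, and only those, are saturated. -/
theorem le_sum_mul_min_iff {N t : ℕ} (ht : t ≤ N) {w b : ℕ → ℝ} {α x M γ : ℝ}
    (hw : ∀ j, 0 ≤ w j) (hb : ∀ j < N, 0 ≤ b j)
    (hsat : ∀ j < t, α ≤ b j * x) (hunsat : ∀ j < N, t ≤ j → b j * x ≤ α)
    (hpos : 0 < ∑ j ∈ Ico t N, w j * b j)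
    (hM : M = (∑ j ∈ range t, w j) * α + (∑ j ∈ Ico t N, w j * b j) * x) :
    M ≤ ∑ j ∈ range N, w j * min α (b j * γ) ↔ x ≤ γ := by
  rw [hM, ← sum_range_add_sum_Ico _ ht, sum_mul, sum_mul]
  constructor
  · intro h
    have h₁ : ∑ j ∈ range t, w j * min α (b j * γ) ≤ ∑ j ∈ range t, w j * α :=
      sum_le_sum fun j _ => mul_le_mul_of_nonneg_left (min_le_left _ _) (hw j)
    have h₂ : ∑ j ∈ Ico t N, w j * min α (b j * γ) ≤ (∑ j ∈ Ico t N, w j * b j) * γ := by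
      rw [sum_mul]
      refine sum_le_sum fun j _ => ?_
      rw [mul_assoc]
      exact mul_le_mul_of_nonneg_left (min_le_right _ _) (hw j)
    rw [← sum_mul (Ico t N)] at h
    exact le_of_mul_le_mul_left (by linarith) hpos
  · intro h
    refine add_le_add (sum_le_sum fun j hj => ?_) (sum_le_sum fun j hj => ?_)
    · rw [mem_range] at hj
      exact mul_le_mul_of_nonneg_left
        (le_min le_rfl ((hsat j hj).trans
          (mul_le_mul_of_nonneg_left h (hb j (hj.trans_le ht))))) (hw j)
    · rw [mem_Ico] at hj
      rw [mul_assoc]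
      exact mul_le_mul_of_nonneg_left
        (le_min (hunsat j hj.2 hj.1) (mul_le_mul_of_nonneg_left h (hb j hj.2))) (hw j)

theorem bFun_antitone {nI : ℕ} (h : 1 < nI) : Antitone (bFun nI) := by
  intro i j hij
  have : (0 : ℝ) < (nI : ℝ) - 1 := sub_pos.2 (by exact_mod_cast h)
  have hij' : (i : ℝ) ≤ j := by exact_mod_cast hij
  unfold bFun
  gcongr

theorem bFun_eq {nI : ℕ} (h : 1 < nI) (j : ℕ) :
    bFun nI j = ((nI : ℝ) - (j + 1 : ℕ)) / ((nI : ℝ) - 1) := by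
  have : (nI : ℝ) - 1 ≠ 0 := (sub_pos.2 (by exact_mod_cast h)).ne'
  unfold bFun
  push_cast
  field_simp
  ring

theorem bFun_nonneg {nI j : ℕ} (h : 1 < nI) (hj : j < nI) : 0 ≤ bFun nI j := by
  rw [bFun_eq h]
  have h₁ : (1 : ℝ) < nI := by exact_mod_cast h
  have h₂ : ((j + 1 : ℕ) : ℝ) ≤ nI := by exact_mod_cast hj
  exact div_nonneg (by linarith) (by linarith)

theorem bFun_pos {nI j : ℕ} (h : 1 < nI) (hj : j + 1 < nI) : 0 < bFun nI j := by
  rw [bFun_eq h]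
  have h₁ : (1 : ℝ) < nI := by exact_mod_cast h
  have h₂ : ((j + 1 : ℕ) : ℝ) < nI := by exact_mod_cast hj
  exact div_pos (by linarith) (by linarith)

theorem gFun_succ (nI k j : ℕ) :
    (gFun nI k (j + 1) : ℝ) = ((k / nI : ℕ) : ℝ) + if j < k % nI then 1 else 0 := by
  unfold gFun
  by_cases h : j < k % nI
  · rw [if_pos ⟨by omega, by omega⟩, if_pos h]; push_cast; ring
  · rw [if_neg (by omega), if_neg h]; ring

theorem gFun_one_pos {nI k : ℕ} (hk : 1 ≤ k) : 0 < gFun nI k 1 := by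
  unfold gFun
  split_ifs with h
  · exact Nat.succ_pos _
  · refine Nat.pos_of_ne_zero fun h0 => ?_
    have := Nat.div_add_mod k nI
    rw [h0, mul_zero, zero_add] at this
    omega

theorem C0_eq_sum_range {nI : ℕ} (h : 1 < nI) (k : ℕ) (α γI : ℝ) :
    C0 nI k α γI =
      ∑ j ∈ range nI, (gFun nI k (j + 1) : ℝ) * min α (bFun nI j * γI) := by
  simp only [bFun_eq h]
  rw [C0, range_eq_Ico,
    sum_Ico_add' (fun i : ℕ => (gFun nI k i : ℝ) * min α (((nI : ℝ) - i) / ((nI : ℝ) - 1) * γI))]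
  rfl

theorem epsFun_eq_sum {nI : ℕ} (h : 0 < nI) (k t : ℕ) :
    epsFun nI k t = ∑ j ∈ Ico t nI, (gFun nI k (j + 1) : ℝ) * bFun nI j := by
  have hr : k % nI < nI := Nat.mod_lt k h
  have hI : Ico t (k % nI) = (Ico t nI).filter (· < k % nI) := by
    ext j
    simp only [mem_Ico, mem_filter]
    omega
  simp only [gFun_succ, add_mul, sum_add_distrib, ite_mul, one_mul, zero_mul]
  rw [epsFun, mul_sum, hI, sum_filter]

theorem deltaFun_eq_sum (nI k t : ℕ) :
    deltaFun nI k t = ∑ j ∈ range t, (gFun nI k (j + 1) : ℝ) := by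
  have hk : (nI : ℝ) * ((k / nI : ℕ) : ℝ) + ((k % nI : ℕ) : ℝ) = k := by
    exact_mod_cast Nat.div_add_mod k nI
  have hI : (range t).filter (· < k % nI) = range (min t (k % nI)) := by
    ext j
    simp only [mem_range, mem_filter]
    omega
  simp only [gFun_succ, sum_add_distrib, sum_const, card_range, nsmul_eq_mul]
  rw [← sum_filter, hI, sum_const, card_range, nsmul_eq_mul, deltaFun]
  split_ifs with h
  · rw [min_eq_left h]; ring
  · rw [min_eq_right (by omega)]; linear_combination -hk

theorem epsFun_eq_add {nI t : ℕ} (h : t < nI) (k : ℕ) :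
    epsFun nI k t = gFun nI k (t + 1) * bFun nI t + epsFun nI k (t + 1) := by
  rw [epsFun_eq_sum (by omega), epsFun_eq_sum (by omega), sum_eq_sum_Ico_succ_bot h]

theorem deltaFun_succ (nI k t : ℕ) :
    deltaFun nI k (t + 1) = deltaFun nI k t + gFun nI k (t + 1) := by
  rw [deltaFun_eq_sum, deltaFun_eq_sum, sum_range_succ]

theorem epsFun_nonneg {nI : ℕ} (h : 1 < nI) (k t : ℕ) : 0 ≤ epsFun nI k t := by
  rw [epsFun_eq_sum (by omega)]
  exact sum_nonneg fun j hj =>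
    mul_nonneg (Nat.cast_nonneg _) (bFun_nonneg h (mem_Ico.1 hj).2)

theorem epsFun_zero_pos {nI k : ℕ} (h : 1 < nI) (hk : 1 ≤ k) : 0 < epsFun nI k 0 := by
  rw [epsFun_eq_add (by omega)]
  have h₁ : (0 : ℝ) < gFun nI k (0 + 1) := by exact_mod_cast gFun_one_pos hk
  exact add_pos_of_pos_of_nonneg (mul_pos h₁ (bFun_pos h (by omega))) (epsFun_nonneg h k _)

theorem deltaFun_succ_pos {nI k : ℕ} (hk : 1 ≤ k) (t : ℕ) : 0 < deltaFun nI k (t + 1) := by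
  rw [deltaFun_eq_sum]
  have h₁ : (0 : ℝ) < gFun nI k (0 + 1) := by exact_mod_cast gFun_one_pos hk
  exact sum_pos' (fun j _ => Nat.cast_nonneg _) ⟨0, by simp, h₁⟩

/-- Consecutive breakpoints share the linear piece indexed by `t + 1`. -/
theorem epsFun_div_bFun_add_deltaFun {nI t : ℕ} (h : t + 1 < nI) (k : ℕ) :
    epsFun nI k t / bFun nI t + deltaFun nI k t =
      epsFun nI k (t + 1) / bFun nI t + deltaFun nI k (t + 1) := by
  have := (bFun_pos (by omega) h).ne'
  rw [epsFun_eq_add (by omega), deltaFun_succ]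
  field_simp
  ring

/-- **Corollary 1: intra-cluster repairable condition.** With the threshold function
`γ_I^*(α) = (M − δ_t α)/ε_t` on `α ∈ [M/(ε_t/b_t + δ_t), M/(ε_{t−1}/b_{t−1} + δ_{t−1}))`
for `1 ≤ t ≤ n_I − 2`, and `γ_I^*(α) = M/ε_0` on `α ≥ M/ε_0`, we have: for every `α` in the
above range and every `γ_I ≥ 0`, `C_0(α, γ_I) ≥ M` if and only if `γ_I ≥ γ_I^*(α)`. -/
theorem intra_cluster_repairable_condition
    (n L k nI : ℕ) (hL : 2 ≤ L) (hn : n = L * nI) (hnI : 3 ≤ nI)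
    (hk1 : 1 ≤ k) (hkn : k ≤ n) (M : ℝ) (hM : 0 < M) :
    (∀ t : ℕ, 1 ≤ t → t ≤ nI - 2 → ∀ α : ℝ, 0 ≤ α →
      M / (epsFun nI k t / bFun nI t + deltaFun nI k t) ≤ α →
      α < M / (epsFun nI k (t - 1) / bFun nI (t - 1) + deltaFun nI k (t - 1)) →
      ∀ γI : ℝ, 0 ≤ γI →
        (M ≤ C0 nI k α γI ↔ (M - deltaFun nI k t * α) / epsFun nI k t ≤ γI)) ∧
    (∀ α : ℝ, 0 ≤ α → M / epsFun nI k 0 ≤ α →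
      ∀ γI : ℝ, 0 ≤ γI → (M ≤ C0 nI k α γI ↔ M / epsFun nI k 0 ≤ γI)) := by
  have hnI' : 1 < nI := by omega
  constructor
  · intro t ht₁ ht₂ α hα hlo hhi γI _
    obtain ⟨s, rfl⟩ : ∃ s, t = s + 1 := ⟨t - 1, by omega⟩
    rw [Nat.add_sub_cancel, epsFun_div_bFun_add_deltaFun (by omega)] at hhi
    have hδ := deltaFun_succ_pos (nI := nI) hk1 s
    have hb := bFun_pos (j := s + 1) hnI' (by omega)
    have hb' := bFun_pos (j := s) hnI' (by omega)
    have hε₀ := epsFun_nonneg hnI' k (s + 1)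
    rw [div_le_iff₀ (by positivity)] at hlo
    rw [lt_div_iff₀ (by positivity)] at hhi
    have hε : 0 < epsFun nI k (s + 1) := by
      refine hε₀.lt_of_ne fun h => ?_
      rw [← h, zero_div] at hlo hhi
      linarith
    set x := (M - deltaFun nI k (s + 1) * α) / epsFun nI k (s + 1) with hx
    have hxε : M = deltaFun nI k (s + 1) * α + epsFun nI k (s + 1) * x := by
      rw [hx]; field_simp; ring
    have hlo' : bFun nI (s + 1) * x ≤ α := by
      rw [mul_comm, ← le_div_iff₀ hb]
      refine le_of_mul_le_mul_left (?_ : epsFun nI k (s + 1) * x ≤ _) hε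
      have : epsFun nI k (s + 1) * (α / bFun nI (s + 1)) =
        α * (epsFun nI k (s + 1) / bFun nI (s + 1)) := by ring
      linarith
    have hhi' : α ≤ bFun nI s * x := by
      rw [mul_comm, ← div_le_iff₀ hb']
      refine le_of_mul_le_mul_left (?_ : _ ≤ epsFun nI k (s + 1) * x) hε
      have : epsFun nI k (s + 1) * (α / bFun nI s) =
        α * (epsFun nI k (s + 1) / bFun nI s) := by ring
      linarith
    have hx₀ : 0 ≤ x := nonneg_of_mul_nonneg_right (hα.trans hhi') hb'
    rw [epsFun_eq_sum (by omega)] at hε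
    rw [deltaFun_eq_sum, epsFun_eq_sum (by omega)] at hxε
    rw [C0_eq_sum_range hnI']
    refine le_sum_mul_min_iff (by omega) (fun _ => Nat.cast_nonneg _)
      (fun j hj => bFun_nonneg hnI' hj) (fun j hj => hhi'.trans ?_)
      (fun j _ hj => le_trans ?_ hlo') hε hxε
    · exact mul_le_mul_of_nonneg_right (bFun_antitone hnI' (by omega)) hx₀
    · exact mul_le_mul_of_nonneg_right (bFun_antitone hnI' hj) hx₀
  · intro α _ hlo γI _
    have hε := epsFun_zero_pos hnI' hk1
    set x := M / epsFun nI k 0 with hx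
    have hx₀ : 0 ≤ x := by positivity
    have hxε : M = epsFun nI k 0 * x := by rw [hx]; field_simp
    rw [epsFun_eq_sum (by omega)] at hε hxε
    rw [C0_eq_sum_range hnI']
    refine le_sum_mul_min_iff (Nat.zero_le _) (fun _ => Nat.cast_nonneg _)
      (fun j hj => bFun_nonneg hnI' hj) (fun j hj => absurd hj (Nat.not_lt_zero j))
      (fun j _ hj => le_trans ?_ hlo) hε (by simpa using hxε)
    have h₁ : bFun nI j ≤ 1 := by simpa [bFun] using bFun_antitone hnI' hj
    exact mul_le_of_le_one_left hx₀ h₁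
end
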